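/- Suppose E[S] = 1, and for some r > 2 both E[S^r] < ∞ and E[A^r] < ∞. Let n' ≥ 1 be an integer with μ_A < n' (equivalently ρ_{n'} := μ_A/n' < 1). Then for all z > 0, P(sup_{t ≥ 0}(A(t) − ∑_{i=1}^{n'} N_i(t)) ≥ z) ≤ (E[S^r])^3 E[A^r] μ_A^r (10^{26} r^8 (r−2)^{−3})^{4r} (z(1 − ρ_{n'}))^{−r/2}. -/

import Mathlib

open MeasureTheory ProbabilityTheory
open scoped NNReal ENNReal

/-- The number of renewals in `[0, t]` of a renewal process whose successive renewal
intervals are `ξ 0, ξ 1, ξ 2, ...`. -/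
noncomputable def renewalCount (ξ : ℕ → ℝ) (t : ℝ) : ℕ :=
  sSup {n : ℕ | ∑ i ∈ Finset.range n, ξ i ≤ t}

lemma phi_lip (r : ℝ) (hr : 2 < r) (x y : ℝ) (s : ℝ) (hs : s ∈ Set.Icc (0:ℝ) 1) :
    |(|x + s * y| ^ (r-2) * (x + s * y)) - |x| ^ (r-2) * x| ≤ (r-1) * (|x| + |y|) ^ (r-2) * |y| := by
  have hd : ∀ u : ℝ, HasDerivAt (fun u : ℝ => |u| ^ (r-2) * u) ((r-1) * |u| ^ (r-2)) u := by
    intro u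
    rcases lt_trichotomy u 0 with hu | hu | hu
    · have h1 : HasDerivAt (fun u : ℝ => -((-u) ^ (r-1))) ((r-1) * |u| ^ (r-2)) u := by
        have := ((hasDerivAt_id u).neg.rpow_const (p := r-1) (Or.inl (by simp; exact hu.ne))).neg
        refine HasDerivAt.congr_deriv this ?_
        rw [abs_of_neg hu]; simp; ring_nf
      refine h1.congr_of_eventuallyEq ?_
      filter_upwards [gt_mem_nhds hu] with v hv
      rw [abs_of_neg hv, show r - 1 = (r-2) + 1 by ring, Real.rpow_add (by linarith), Real.rpow_one]; ring
    · subst hu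
      have h0 : (0:ℝ) ^ (r-2) = 0 := Real.zero_rpow (by linarith)
      simp only [abs_zero, h0, mul_zero]
      rw [hasDerivAt_iff_tendsto_slope]
      have hc : ContinuousAt (fun u : ℝ => |u| ^ (r-2)) 0 :=
        (continuous_abs.continuousAt).rpow_const (Or.inr (by linarith))
      have := hc.tendsto
      simp only [abs_zero, h0] at this
      refine (this.mono_left nhdsWithin_le_nhds).congr' ?_
      filter_upwards [self_mem_nhdsWithin] with v hv
      have hv' : v ≠ 0 := hv
      simp [slope]
      field_simp
    · have h1 : HasDerivAt (fun u : ℝ => (u ^ (r-1))) ((r-1) * |u| ^ (r-2)) u := by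
        have := ((hasDerivAt_id u).rpow_const (p := r-1) (Or.inl (by simp; exact hu.ne')))
        refine HasDerivAt.congr_deriv this ?_
        rw [abs_of_pos hu]; simp; left; ring_nf
      refine h1.congr_of_eventuallyEq ?_
      filter_upwards [lt_mem_nhds hu] with v hv
      rw [abs_of_pos hv, show r - 1 = (r-2) + 1 by ring, Real.rpow_add (by linarith), Real.rpow_one]
  have hsy : |s * y| ≤ |y| := by
    rw [abs_mul, abs_of_nonneg hs.1]; nlinarith [abs_nonneg y, hs.2]
  have := Convex.norm_image_sub_le_of_norm_hasDerivWithin_le (𝕜 := ℝ) (f := fun u : ℝ => |u| ^ (r-2) * u)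
    (f' := fun u => (r-1) * |u| ^ (r-2)) (s := Set.Icc (-(|x| + |y|)) (|x|+|y|)) (x := x) (y := x + s * y)
    (C := (r-1) * (|x| + |y|) ^ (r-2))
    (fun u _ => (hd u).hasDerivWithinAt) (by
      intro u hu
      rw [Real.norm_eq_abs, abs_of_nonneg (by have := Real.rpow_nonneg (abs_nonneg u) (r-2); nlinarith)]
      have : |u| ≤ |x| + |y| := abs_le.2 hu
      have := Real.rpow_le_rpow (abs_nonneg u) this (z := r-2) (by linarith)
      nlinarith) (convex_Icc _ _) (by
        rw [Set.mem_Icc, ← abs_le]; linarith [abs_nonneg y]) (by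
        rw [Set.mem_Icc, ← abs_le]; linarith [abs_add_le x (s*y)])
  simp only [Real.norm_eq_abs] at this
  refine this.trans ?_
  have h0 : 0 ≤ (r-1) * (|x| + |y|) ^ (r-2) := mul_nonneg (by linarith) (Real.rpow_nonneg (by positivity) _)
  rw [add_sub_cancel_left]
  exact mul_le_mul_of_nonneg_left hsy h0

lemma one_step_ineq (r : ℝ) (hr : 2 < r) (x y : ℝ) :
    |x + y| ^ r ≤ |x| ^ r + r * (|x| ^ (r-2) * x) * y
      + 3 * r^2 * (|x| ^ (r-2) * y^2) + (1+r)^r * |y| ^ r := by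
  have hpos : 0 ≤ |x| ^ (r-2) := Real.rpow_nonneg (abs_nonneg _) _
  have hposy : 0 ≤ |y| ^ (r) := Real.rpow_nonneg (abs_nonneg _) _
  have hder : ∀ s : ℝ, HasDerivAt (fun s : ℝ => |x + s * y| ^ r) (r * |x + s*y| ^ (r-2) * (x + s*y) * y) s := by
    intro s
    have h1 := hasDerivAt_abs_rpow (x + s*y) (p := r) (by linarith)
    have h2 : HasDerivAt (fun s : ℝ => x + s * y) y s := by
      simpa using ((hasDerivAt_id s).mul_const y).const_add x
    exact h1.comp s h2
  obtain ⟨s, hs, hs2⟩ := exists_hasDerivAt_eq_slope (fun s : ℝ => |x + s * y| ^ r)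
    (fun s => r * |x + s*y| ^ (r-2) * (x + s*y) * y) (zero_lt_one)
    (fun s _ => (hder s).continuousAt.continuousWithinAt) (fun s _ => hder s)
  have hl := phi_lip r hr x y s ⟨hs.1.le, hs.2.le⟩
  have key : |x+y|^r ≤ |x| ^ r + r * (|x| ^ (r-2) * x) * y + r * ((r-1) * (|x| + |y|) ^ (r-2) * |y|) * |y| := by
    have e1 : |x+y|^r = |x|^r + r * |x + s*y| ^ (r-2) * (x + s*y) * y := by
      simp at hs2; linarith
    rw [e1]
    have e2 : (|x + s*y| ^ (r-2) * (x + s*y) - |x| ^ (r-2) * x) * y ≤ ((r-1) * (|x| + |y|) ^ (r-2) * |y|) * |y| := by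
      refine (le_abs_self _).trans ?_
      rw [abs_mul]
      exact mul_le_mul_of_nonneg_right hl (abs_nonneg _)
    nlinarith
  refine key.trans ?_
  have hyy : |y| * |y| = y^2 := by rw [← sq, sq_abs]
  rcases le_or_gt (r * |y|) |x| with h | h
  · have hxy : (|x| + |y|) ^ (r-2) ≤ 3 * |x| ^ (r-2) := by
      have h1 : |x| + |y| ≤ |x| * (1 + 1/r) := by
        have : |y| ≤ |x| / r := by rw [le_div_iff₀ (by linarith)]; linarith
        have e: |x| * (1+1/r) = |x| + |x|/r := by ring
        linarith
      calc (|x| + |y|) ^ (r-2) ≤ (|x| * (1 + 1/r)) ^ (r-2) :=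
            Real.rpow_le_rpow (by positivity) h1 (by linarith)
        _ = |x| ^ (r-2) * (1+1/r) ^ (r-2) := Real.mul_rpow (abs_nonneg _) (by positivity)
        _ ≤ |x| ^ (r-2) * 3 := by
            refine mul_le_mul_of_nonneg_left ?_ hpos
            have : (1 + 1/r) ≤ Real.exp (1/r) := by linarith [Real.add_one_le_exp (1/r)]
            calc (1+1/r)^(r-2) ≤ (Real.exp (1/r)) ^ (r-2) := Real.rpow_le_rpow (by positivity) this (by linarith)
              _ = Real.exp ((1/r) * (r-2)) := by rw [← Real.exp_mul]
              _ ≤ Real.exp 1 := by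
                  apply Real.exp_le_exp.2
                  rw [one_div, inv_mul_le_iff₀ (by linarith)]; linarith
              _ ≤ 3 := by linarith [Real.exp_one_lt_d9]
        _ = _ := by ring
    have h3 : r * ((r-1) * (|x| + |y|) ^ (r-2) * |y|) * |y| = r * (r-1) * ((|x| + |y|) ^ (r-2) * y^2) := by rw [← hyy]; ring
    rw [h3]
    have h4 : (|x| + |y|) ^ (r-2) * y^2 ≤ 3 * (|x| ^ (r-2) * y^2) := by nlinarith [sq_nonneg y]
    have h5 : r * (r-1) * ((|x| + |y|) ^ (r-2) * y^2) ≤ r * (r-1) * (3 * (|x| ^ (r-2) * y^2)) := by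
      apply mul_le_mul_of_nonneg_left h4; nlinarith
    have h6 : 0 ≤ |x| ^ (r-2) * y^2 := by positivity
    have h7 : 0 ≤ (1+r)^r * |y|^r := by positivity
    nlinarith
  · have hy0 : 0 < |y| := by
      by_contra hc
      have : |y| = 0 := le_antisymm (not_lt.1 hc) (abs_nonneg _)
      rw [this] at h; simp at h
      linarith [abs_nonneg x]
    have hxy : (|x| + |y|) ^ (r-2) ≤ (1+r)^(r-2) * |y| ^ (r-2) := by
      rw [← Real.mul_rpow (by linarith) hy0.le]
      exact Real.rpow_le_rpow (by positivity) (by linarith) (by linarith)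
    have e1 : |y| ^ r = |y| ^ (r-2) * (|y| * |y|) := by
      rw [show r = (r-2) + 2 by ring, Real.rpow_add hy0]; simp [sq]
    have e2 : (1+r) ^ r = (1+r) ^ (r-2) * ((1+r)*(1+r)) := by
      conv_lhs => rw [show r = (r-2) + 2 by ring, Real.rpow_add (by linarith)]
      simp [sq]
    have h6 : 0 ≤ 3 * r^2 * (|x| ^ (r-2) * y^2) := by positivity
    have h8 : r * ((r-1) * (|x| + |y|) ^ (r-2) * |y|) * |y| ≤ r * ((r-1) * ((1+r)^(r-2) * |y| ^ (r-2)) * |y|) * |y| := by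
      gcongr; linarith
    have h9 : 0 ≤ (1+r)^(r-2) * |y| ^ (r-2) * (|y| * |y|) := by positivity
    rw [e1, e2]
    have : r * ((r-1) * ((1+r)^(r-2) * |y| ^ (r-2)) * |y|) * |y| = r*(r-1) * ((1+r)^(r-2) * |y| ^ (r-2) * (|y| * |y|)) := by ring
    nlinarith

lemma rpow_le_one_add (a p r : ℝ) (ha : 0 ≤ a) (hp : 0 ≤ p) (hpr : p ≤ r) : a ^ p ≤ 1 + a ^ r := by
  have h0 : 0 ≤ a ^ r := Real.rpow_nonneg ha _
  rcases le_total a 1 with h | h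
  · have := Real.rpow_le_one ha h hp; linarith
  · have := Real.rpow_le_rpow_of_exponent_le h hpr; linarith

lemma integrable_rpow_of_le {Ω : Type*} [MeasurableSpace Ω] {μ : Measure Ω} [IsProbabilityMeasure μ]
    {X : Ω → ℝ} (hX : Measurable X) {p r : ℝ} (hp : 0 ≤ p) (hpr : p ≤ r)
    (h : Integrable (fun ω => |X ω| ^ r) μ) : Integrable (fun ω => |X ω| ^ p) μ := by
  refine Integrable.mono' ((integrable_const (1:ℝ)).add h) (by fun_prop) ?_
  filter_upwards with ω
  rw [Real.norm_eq_abs, abs_of_nonneg (by positivity)]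
  exact rpow_le_one_add _ _ _ (abs_nonneg _) hp hpr

lemma lyapunov {Ω : Type*} [MeasurableSpace Ω] {μ : Measure Ω} [IsProbabilityMeasure μ]
    {X : Ω → ℝ} (hX : Measurable X) {p r : ℝ} (hp : 0 ≤ p) (hpr : p ≤ r) (hr : 0 < r)
    (h : Integrable (fun ω => |X ω| ^ r) μ) :
    ∫ ω, |X ω| ^ p ∂μ ≤ (∫ ω, |X ω| ^ r ∂μ) ^ (p / r) := by
  have e : ∀ ω, |X ω| ^ p = (|X ω| ^ r) ^ (p / r) := by
    intro ω
    rw [← Real.rpow_mul (abs_nonneg _)]; congr 1; field_simp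
  have := (Real.concaveOn_rpow (p := p / r) (by positivity) (by rw [div_le_one hr]; exact hpr)).le_map_integral
    (μ := μ) (f := fun ω => |X ω| ^ r) (continuousOn_id.rpow_const (fun x _ => Or.inr (by positivity))) isClosed_Ici
    (Filter.Eventually.of_forall fun ω => Real.rpow_nonneg (abs_nonneg _) _) h (by
      have := integrable_rpow_of_le hX hp hpr h
      simp only [e] at this; exact this)
  simp only [e]
  exact this

lemma rosenthal {Ω : Type*} [MeasurableSpace Ω] {μ : Measure Ω} [IsProbabilityMeasure μ]
    (W : ℕ → Ω → ℝ) (hW : ∀ i, Measurable (W i)) (hind : iIndepFun W μ) (r : ℝ) (hr : 2 < r)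
    (hInt : ∀ i, Integrable (fun ω => |W i ω| ^ r) μ) (hmean : ∀ i, ∫ ω, W i ω ∂μ = 0)
    (σ2 m : ℝ) (h2 : ∀ i, ∫ ω, (W i ω)^2 ∂μ ≤ σ2) (hm : ∀ i, ∫ ω, |W i ω| ^ r ∂μ ≤ m)
    (n : ℕ) (hn : 1 ≤ n) :
    Integrable (fun ω => |∑ i ∈ Finset.range n, W i ω| ^ r) μ ∧
      ∫ ω, |∑ i ∈ Finset.range n, W i ω| ^ r ∂μ ≤ (6 * r^2 * n * σ2) ^ (r/2) + 2 * (1+r)^r * n * m := by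
  have hσ : 0 ≤ σ2 := le_trans (integral_nonneg fun ω => sq_nonneg _) (h2 0)
  have hm0 : 0 ≤ m := le_trans (integral_nonneg fun ω => by positivity) (hm 0)
  have hn0 : (0:ℝ) < n := by exact_mod_cast hn
  set M : ℝ := (6 * r^2 * n * σ2) ^ (r/2) + 2 * (1+r)^r * n * m with hM
  have hM0 : 0 ≤ M := by positivity
  have hA1 : 3 * r^2 * σ2 * M ^ ((r-2)/r) ≤ M / (2*n) := by
    have h1 : 6 * r^2 * n * σ2 ≤ M ^ (2/r) := by
      calc 6 * r^2 * n * σ2 = ((6 * r^2 * n * σ2) ^ (r/2)) ^ (2/r) := by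
            rw [← Real.rpow_mul (by positivity)]
            have : r/2 * (2/r) = 1 := by field_simp
            rw [this, Real.rpow_one]
        _ ≤ M ^ (2/r) := by
            apply Real.rpow_le_rpow (by positivity) _ (by positivity)
            rw [hM]; have : 0 ≤ 2 * (1+r)^r * n * m := by positivity
            linarith
    rw [le_div_iff₀ (by positivity)]
    have h3 : M ^ (2/r) * M ^ ((r-2)/r) = M := by
      rcases hM0.eq_or_lt with h | h
      · rw [← h, Real.zero_rpow (by positivity)]; simp
      · rw [← Real.rpow_add h]
        have : 2/r + (r-2)/r = 1 := by field_simp; ring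
        rw [this, Real.rpow_one]
    have h4 : 0 ≤ M ^ ((r-2)/r) := by positivity
    calc 3 * r^2 * σ2 * M ^ ((r-2)/r) * (2*n) = (6 * r^2 * n * σ2) * M ^ ((r-2)/r) := by ring
      _ ≤ M ^ (2/r) * M ^ ((r-2)/r) := mul_le_mul_of_nonneg_right h1 h4
      _ = M := h3
  have hA2 : (1+r)^r * m ≤ M / (2*n) := by
    rw [le_div_iff₀ (by positivity), hM]
    have : 0 ≤ (6 * r^2 * n * σ2) ^ (r/2) := by positivity
    nlinarith
  have main : ∀ k : ℕ, k ≤ n → Integrable (fun ω => |∑ i ∈ Finset.range k, W i ω| ^ r) μ ∧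
      ∫ ω, |∑ i ∈ Finset.range k, W i ω| ^ r ∂μ ≤ (k:ℝ) / n * M := by
    intro k
    induction k with
    | zero =>
      intro _
      simp [Real.zero_rpow (show r ≠ 0 by linarith)]
    | succ k ih =>
      intro hk
      obtain ⟨ihI, ihB⟩ := ih (by omega)
      set T : Ω → ℝ := fun ω => ∑ i ∈ Finset.range k, W i ω with hT
      have hTm : Measurable T := by fun_prop
      have hTW : IndepFun T (W k) μ := by
        have := hind.indepFun_sum_range_succ hW k
        convert this using 1
        ext ω; simp [hT]
      have i1 : Integrable (fun ω => |T ω| ^ (r-2)) μ := integrable_rpow_of_le hTm (by linarith) (by linarith) ihI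
      have i2 : Integrable (fun ω => |T ω| ^ (r-2) * T ω) μ := by
        refine (integrable_rpow_of_le hTm (p := r-1) (by linarith) (by linarith) ihI).mono' (by fun_prop) ?_
        filter_upwards with ω
        rw [Real.norm_eq_abs, abs_mul, abs_of_nonneg (Real.rpow_nonneg (abs_nonneg _) _)]
        rw [show r - 1 = (r-2) + 1 by ring, Real.rpow_add_one' (abs_nonneg _) (by linarith)]
      have i3 : Integrable (W k) μ := by
        have := integrable_rpow_of_le (hW k) (p := 1) (by linarith) (by linarith) (hInt k)
        simp only [Real.rpow_one] at this
        exact (integrable_norm_iff (hW k).aestronglyMeasurable).1 this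
      have i4 : Integrable (fun ω => (W k ω)^2) μ := by
        have := integrable_rpow_of_le (hW k) (p := 2) (by linarith) (by linarith) (hInt k)
        simpa using this
      have ind1 : IndepFun (fun ω => |T ω| ^ (r-2) * T ω) (W k) μ :=
        hTW.comp (φ := fun x => |x| ^ (r-2) * x) (ψ := id) (by fun_prop) measurable_id
      have ind2 : IndepFun (fun ω => |T ω| ^ (r-2)) (fun ω => (W k ω)^2) μ :=
        hTW.comp (φ := fun x => |x| ^ (r-2)) (ψ := fun x => x^2) (by fun_prop) (by fun_prop)
      have j1 : Integrable (fun ω => (|T ω| ^ (r-2) * T ω) * W k ω) μ := ind1.integrable_mul i2 i3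
      have j2 : Integrable (fun ω => |T ω| ^ (r-2) * (W k ω)^2) μ := ind2.integrable_mul i1 i4
      have e1 : ∫ ω, (|T ω| ^ (r-2) * T ω) * W k ω ∂μ = 0 := by
        have := ind1.integral_fun_mul_eq_mul_integral i2.aestronglyMeasurable i3.aestronglyMeasurable
        rw [this, hmean k, mul_zero]
      have e2 : ∫ ω, |T ω| ^ (r-2) * (W k ω)^2 ∂μ ≤ M ^ ((r-2)/r) * σ2 := by
        have := ind2.integral_fun_mul_eq_mul_integral i1.aestronglyMeasurable i4.aestronglyMeasurable
        rw [this]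
        have hb : ∫ ω, |T ω| ^ (r-2) ∂μ ≤ M ^ ((r-2)/r) := by
          refine (lyapunov hTm (by linarith) (by linarith) (by linarith) ihI).trans ?_
          refine Real.rpow_le_rpow (integral_nonneg fun ω => by positivity) (ihB.trans ?_) (div_nonneg (by linarith) (by linarith))
          have : (k:ℝ)/n ≤ 1 := by rw [div_le_one hn0]; exact_mod_cast (by omega : k ≤ n)
          nlinarith
        exact mul_le_mul hb (h2 k) (integral_nonneg fun ω => sq_nonneg _) (by positivity)
      have hdom : Integrable (fun ω => |T ω| ^ r + r * ((|T ω| ^ (r-2) * T ω) * W k ω)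
          + 3 * r^2 * (|T ω| ^ (r-2) * (W k ω)^2) + (1+r)^r * |W k ω| ^ r) μ :=
        ((ihI.add (j1.const_mul r)).add (j2.const_mul _)).add ((hInt k).const_mul _)
      have hle : ∀ ω, |∑ i ∈ Finset.range (k+1), W i ω| ^ r ≤ |T ω| ^ r + r * ((|T ω| ^ (r-2) * T ω) * W k ω)
          + 3 * r^2 * (|T ω| ^ (r-2) * (W k ω)^2) + (1+r)^r * |W k ω| ^ r := by
        intro ω
        rw [Finset.sum_range_succ]
        have := one_step_ineq r hr (T ω) (W k ω)
        rw [mul_assoc r] at this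
        exact this
      have hI : Integrable (fun ω => |∑ i ∈ Finset.range (k+1), W i ω| ^ r) μ := by
        refine hdom.mono' (by apply Measurable.aestronglyMeasurable; fun_prop) ?_
        filter_upwards with ω
        rw [Real.norm_eq_abs, abs_of_nonneg (by positivity)]
        exact hle ω
      refine ⟨hI, (integral_mono hI hdom hle).trans ?_⟩
      have ihI' : Integrable (fun ω => |T ω| ^ r) μ := ihI
      have q1 : Integrable (fun ω => |T ω| ^ r + r * ((|T ω| ^ (r-2) * T ω) * W k ω)) μ :=
        ihI.add (j1.const_mul r)
      have q2 : Integrable (fun ω => |T ω| ^ r + r * ((|T ω| ^ (r-2) * T ω) * W k ω)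
          + 3 * r^2 * (|T ω| ^ (r-2) * (W k ω)^2)) μ := q1.add (j2.const_mul _)
      rw [integral_add q2 ((hInt k).const_mul _), integral_add q1 (j2.const_mul _),
        integral_add ihI' (j1.const_mul r), integral_const_mul, integral_const_mul, integral_const_mul, e1]
      have f1 : 3 * r^2 * ∫ ω, |T ω| ^ (r-2) * (W k ω)^2 ∂μ ≤ M / (2*n) := by
        refine le_trans ?_ hA1
        rw [mul_assoc (3 * r^2), mul_comm σ2]
        exact mul_le_mul_of_nonneg_left e2 (by positivity)
      have f2 : (1+r)^r * ∫ ω, |W k ω| ^ r ∂μ ≤ M / (2*n) :=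
        le_trans (mul_le_mul_of_nonneg_left (hm k) (by positivity)) hA2
      have : ((k+1 : ℕ) : ℝ) / n * M = (k:ℝ)/n * M + M/(2*n) + M/(2*n) := by
        push_cast; field_simp; ring
      rw [this]
      linarith
  have := main n le_rfl
  rw [div_self hn0.ne', one_mul] at this
  exact this

lemma measurable_finset_sup {Ω ι : Type*} [MeasurableSpace Ω] (s : Finset ι) (f : ι → Ω → ℝ≥0∞)
    (hf : ∀ i, Measurable (f i)) : Measurable (fun ω => s.sup (fun i => f i ω)) := by
  classical
  induction s using Finset.induction_on with
  | empty => simp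
  | insert a s ha ih =>
    simp only [Finset.sup_insert]
    exact (hf a).sup ih

/-- running maximum over a dyadic range -/
noncomputable def gMax {Ω : Type*} (X : ℕ → Ω → ℝ) (m : ℕ) (ω : Ω) : ℝ≥0∞ :=
  (Finset.range (2^m+1)).sup (fun k => ENNReal.ofReal |X k ω|)

lemma measurable_gMax {Ω : Type*} [MeasurableSpace Ω] (X : ℕ → Ω → ℝ) (hX : ∀ k, Measurable (X k)) (m : ℕ) :
    Measurable (gMax X m) := by
  unfold gMax
  exact measurable_finset_sup _ _ (fun i => by fun_prop)

lemma le_gMax {Ω : Type*} (X : ℕ → Ω → ℝ) (m k : ℕ) (hk : k ≤ 2^m) (ω : Ω) :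
    ENNReal.ofReal |X k ω| ≤ gMax X m ω :=
  Finset.le_sup (f := fun k => ENNReal.ofReal |X k ω|) (Finset.mem_range.2 (by omega))

lemma sup_rpow_le_sum {ι : Type*} (s : Finset ι) (f : ι → ℝ≥0∞) (r : ℝ) (hr : 0 < r) :
    (s.sup f) ^ r ≤ ∑ i ∈ s, f i ^ r := by
  classical
  induction s using Finset.induction_on with
  | empty => simp [hr]
  | insert a s ha ih =>
    rw [Finset.sup_insert, Finset.sum_insert ha]
    rcases le_total (f a) (s.sup f) with h | h
    · rw [sup_eq_right.2 h]; exact ih.trans le_add_self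
    · rw [sup_eq_left.2 h]; exact le_self_add

lemma ofReal_rpow' (a r : ℝ) (ha : 0 ≤ a) (hr : 0 ≤ r) : ENNReal.ofReal a ^ r = ENNReal.ofReal (a ^ r) :=
  ENNReal.ofReal_rpow_of_nonneg ha hr

lemma chain_aux {Ω : Type*} [MeasurableSpace Ω] {μ : Measure Ω} [IsProbabilityMeasure μ]
    (r : ℝ) (hr : 2 < r) (K' : ℝ) (hK'0 : 0 ≤ K') (hK' : K' * (2 ^ (1/2:ℝ) - 2 ^ (1/r)) = 1) (m : ℕ) :
    ∀ (X : ℕ → Ω → ℝ) (D : ℝ), 0 ≤ D → (∀ k, Measurable (X k)) → (∀ ω, X 0 ω = 0) →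
    (∀ j k : ℕ, 1 ≤ k → ∫⁻ ω, ENNReal.ofReal (|X (j+k) ω - X j ω| ^ r) ∂μ ≤ ENNReal.ofReal (D * (k:ℝ) ^ (r/2))) →
    (∫⁻ ω, gMax X m ω ^ r ∂μ) ^ (1/r) ≤
      ENNReal.ofReal (D ^ (1/r) * ((1+K') * 2 ^ ((m:ℝ)/2) - K' * 2 ^ ((m:ℝ)/r))) := by
  have hr0 : 0 < r := by linarith
  induction m with
  | zero =>
    intro X D hD hX h0 hinc
    have e : ∀ ω, gMax X 0 ω = ENNReal.ofReal |X 1 ω| := by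
      intro ω; simp [gMax, Finset.range_add_one, h0]
    simp only [e]
    have h1 := hinc 0 1 le_rfl
    simp only [zero_add, h0, sub_zero, Nat.cast_one, Real.one_rpow, mul_one] at h1
    have e2 : ∀ ω, ENNReal.ofReal |X 1 ω| ^ r = ENNReal.ofReal (|X 1 ω| ^ r) := fun ω =>
      ofReal_rpow' _ _ (abs_nonneg _) hr0.le
    simp only [e2]
    have := ENNReal.rpow_le_rpow h1 (z := 1/r) (by positivity)
    rw [ofReal_rpow' _ _ hD (by positivity)] at this
    simpa using this
  | succ m ih =>
    intro X D hD hX h0 hinc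
    set Y : ℕ → Ω → ℝ := fun j => X (2*j) with hY
    set H : Ω → ℝ≥0∞ := fun ω => (Finset.range (2^m)).sup (fun j => ENNReal.ofReal |X (2*j+1) ω - X (2*j) ω|) with hH
    have hYb := ih Y (D * 2 ^ (r/2)) (by positivity) (fun k => hX _) (by simpa [hY] using h0) (by
      intro j k hk
      have := hinc (2*j) (2*k) (by omega)
      simp only [hY]
      rw [show 2 * (j+k) = 2*j + 2*k by ring]
      refine this.trans (le_of_eq ?_)
      push_cast
      rw [Real.mul_rpow (by norm_num) (by positivity)]; ring_nf)
    have hle : ∀ ω, gMax X (m+1) ω ≤ gMax Y m ω + H ω := by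
      intro ω
      refine Finset.sup_le ?_
      intro k hk
      rw [Finset.mem_range] at hk
      rcases Nat.even_or_odd' k with ⟨j, rfl | rfl⟩
      · refine le_trans ?_ le_self_add
        exact le_gMax Y m j (by rw [pow_succ] at hk; omega) ω
      · have hj : j < 2^m := by rw [pow_succ] at hk; omega
        have a1 := le_gMax Y m j hj.le ω
        have a2 : ENNReal.ofReal |X (2*j+1) ω - X (2*j) ω| ≤ H ω :=
          Finset.le_sup (f := fun j => ENNReal.ofReal |X (2*j+1) ω - X (2*j) ω|) (Finset.mem_range.2 hj)
        refine le_trans ?_ (add_le_add a1 a2)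
        rw [← ENNReal.ofReal_add (abs_nonneg _) (abs_nonneg _)]
        apply ENNReal.ofReal_le_ofReal
        have := abs_add_le (X (2*j) ω) (X (2*j+1) ω - X (2*j) ω)
        simpa [hY] using this
    have hHm : Measurable H := measurable_finset_sup _ _ (fun i => by fun_prop)
    have hHb : (∫⁻ ω, H ω ^ r ∂μ) ^ (1/r) ≤ ENNReal.ofReal (D ^ (1/r) * 2 ^ ((m:ℝ)/r)) := by
      have h1 : ∫⁻ ω, H ω ^ r ∂μ ≤ ENNReal.ofReal (2^m * D) := by
        calc ∫⁻ ω, H ω ^ r ∂μ ≤ ∫⁻ ω, ∑ j ∈ Finset.range (2^m), ENNReal.ofReal (|X (2*j+1) ω - X (2*j) ω| ^ r) ∂μ := by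
              apply lintegral_mono
              intro ω
              refine (sup_rpow_le_sum _ _ r hr0).trans (le_of_eq ?_)
              refine Finset.sum_congr rfl fun j _ => ofReal_rpow' _ _ (abs_nonneg _) hr0.le
          _ = ∑ j ∈ Finset.range (2^m), ∫⁻ ω, ENNReal.ofReal (|X (2*j+1) ω - X (2*j) ω| ^ r) ∂μ :=
              lintegral_finsetSum _ (fun j _ => by fun_prop)
          _ ≤ ∑ j ∈ Finset.range (2^m), ENNReal.ofReal D := by
              refine Finset.sum_le_sum fun j _ => ?_
              have := hinc (2*j) 1 le_rfl
              simpa using this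
          _ = ENNReal.ofReal (2^m * D) := by
              rw [Finset.sum_const, Finset.card_range, nsmul_eq_mul, ENNReal.ofReal_mul (by positivity)]
              congr 1
              rw [ENNReal.ofReal_pow (by norm_num)]; simp
      refine (ENNReal.rpow_le_rpow h1 (z := 1/r) (by positivity)).trans (le_of_eq ?_)
      rw [ofReal_rpow' _ _ (by positivity) (by positivity), Real.mul_rpow (by positivity) hD, mul_comm]
      congr 2
      rw [← Real.rpow_natCast, ← Real.rpow_mul (by norm_num)]; congr 1; ring
    calc (∫⁻ ω, gMax X (m+1) ω ^ r ∂μ) ^ (1/r) ≤ (∫⁻ ω, (gMax Y m + H) ω ^ r ∂μ) ^ (1/r) := by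
          apply ENNReal.rpow_le_rpow _ (by positivity)
          exact lintegral_mono fun ω => ENNReal.rpow_le_rpow (hle ω) hr0.le
      _ ≤ (∫⁻ ω, gMax Y m ω ^ r ∂μ) ^ (1/r) + (∫⁻ ω, H ω ^ r ∂μ) ^ (1/r) :=
          ENNReal.lintegral_Lp_add_le (measurable_gMax Y (fun k => hX _) m).aemeasurable hHm.aemeasurable (by linarith)
      _ ≤ ENNReal.ofReal ((D * 2 ^ (r/2)) ^ (1/r) * ((1+K') * 2 ^ ((m:ℝ)/2) - K' * 2 ^ ((m:ℝ)/r)))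
          + ENNReal.ofReal (D ^ (1/r) * 2 ^ ((m:ℝ)/r)) := add_le_add hYb hHb
      _ = _ := by
          rw [← ENNReal.ofReal_add]
          · congr 1
            rw [Real.mul_rpow hD (by positivity), ← Real.rpow_mul (by norm_num)]
            rw [show r/2 * (1/r) = 1/2 by field_simp]
            have e1 : (2:ℝ) ^ (((m+1:ℕ):ℝ)/2) = 2 ^ (1/2:ℝ) * 2 ^ ((m:ℝ)/2) := by
              rw [← Real.rpow_add (by norm_num)]; congr 1; push_cast; ring
            have e2 : (2:ℝ) ^ (((m+1:ℕ):ℝ)/r) = 2 ^ (1/r:ℝ) * 2 ^ ((m:ℝ)/r) := by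
              rw [← Real.rpow_add (by norm_num)]; congr 1; push_cast; ring
            rw [e1, e2]
            linear_combination (-(D ^ (1/r) * 2 ^ ((m:ℝ)/r))) * hK'
          · apply mul_nonneg (by positivity)
            have : (2:ℝ) ^ ((m:ℝ)/r) ≤ 2 ^ ((m:ℝ)/2) := by
              apply Real.rpow_le_rpow_of_exponent_le (by norm_num)
              apply div_le_div_of_nonneg_left (by positivity) (by norm_num) hr.le
            have h3 : (0:ℝ) ≤ 2 ^ ((m:ℝ)/2) := by positivity
            nlinarith
          · positivity

lemma chain {Ω : Type*} [MeasurableSpace Ω] {μ : Measure Ω} [IsProbabilityMeasure μ]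
    (r : ℝ) (hr : 2 < r) (X : ℕ → Ω → ℝ) (D : ℝ) (hD : 0 ≤ D) (hX : ∀ k, Measurable (X k)) (h0 : ∀ ω, X 0 ω = 0)
    (hinc : ∀ j k : ℕ, 1 ≤ k → ∫⁻ ω, ENNReal.ofReal (|X (j+k) ω - X j ω| ^ r) ∂μ ≤ ENNReal.ofReal (D * (k:ℝ) ^ (r/2)))
    (m : ℕ) :
    ∫⁻ ω, gMax X m ω ^ r ∂μ ≤ ENNReal.ofReal ((5*r/(r-2)) ^ r * D * (2^m : ℝ) ^ (r/2)) := by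
  have hr0 : 0 < r := by linarith
  have hr2 : 0 < r - 2 := by linarith
  have hd : (r-2)/(4*r) ≤ (2:ℝ) ^ (1/2:ℝ) - 2 ^ (1/r) := by
    have e : (2:ℝ) ^ (1/2:ℝ) = 2 ^ (1/r) * 2 ^ ((r-2)/(2*r)) := by
      rw [← Real.rpow_add (by norm_num)]; congr 1; field_simp; ring
    have h1 : (1:ℝ) ≤ 2 ^ (1/r) := Real.one_le_rpow (by norm_num) (by positivity)
    have h2 : 1 + (r-2)/(4*r) ≤ (2:ℝ) ^ ((r-2)/(2*r)) := by
      rw [Real.rpow_def_of_pos (by norm_num)]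
      have h3 := Real.add_one_le_exp (Real.log 2 * ((r-2)/(2*r)))
      have h4 : (1/2:ℝ) ≤ Real.log 2 := by linarith [Real.log_two_gt_d9]
      have h5 : 0 ≤ (r-2)/(2*r) := by positivity
      have h6 : (r-2)/(4*r) = 1/2 * ((r-2)/(2*r)) := by field_simp; ring
      nlinarith
    have h7 : 0 ≤ (r-2)/(4*r) := by positivity
    rw [e]; nlinarith
  have hd0 : 0 < (r-2)/(4*r) := by positivity
  set d := (2:ℝ) ^ (1/2:ℝ) - 2 ^ (1/r) with hdd
  have hdpos : 0 < d := by linarith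
  have := chain_aux (μ := μ) r hr d⁻¹ (by positivity) (by rw [inv_mul_cancel₀ hdpos.ne']) m X D hD hX h0 hinc
  have hK : 1 + d⁻¹ ≤ 5*r/(r-2) := by
    have h1 : d⁻¹ ≤ ((r-2)/(4*r))⁻¹ := inv_anti₀ hd0 hd
    rw [inv_div] at h1
    have h2 : 1 ≤ r/(r-2) := by rw [le_div_iff₀ hr2]; linarith
    have h3 : 5*r/(r-2) = 4*r/(r-2) + r/(r-2) := by ring
    linarith
  have h1 : (∫⁻ ω, gMax X m ω ^ r ∂μ) ^ (1/r) ≤ ENNReal.ofReal (D ^ (1/r) * ((5*r/(r-2)) * 2 ^ ((m:ℝ)/2))) := by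
    refine this.trans (ENNReal.ofReal_le_ofReal ?_)
    refine mul_le_mul_of_nonneg_left ?_ (by positivity)
    have h3 : 0 ≤ d⁻¹ * (2:ℝ) ^ ((m:ℝ)/r) := by positivity
    have h4 : (1+d⁻¹) * (2:ℝ) ^ ((m:ℝ)/2) ≤ (5*r/(r-2)) * 2 ^ ((m:ℝ)/2) :=
      mul_le_mul_of_nonneg_right hK (by positivity)
    linarith
  have h2 := ENNReal.rpow_le_rpow h1 hr0.le
  rw [← ENNReal.rpow_mul, show 1/r * r = 1 by field_simp, ENNReal.rpow_one] at h2
  refine h2.trans (le_of_eq ?_)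
  rw [ofReal_rpow' _ _ (by positivity) hr0.le]
  congr 1
  rw [Real.mul_rpow (by positivity) (by positivity), Real.mul_rpow (by positivity) (by positivity),
    ← Real.rpow_mul hD, ← Real.rpow_mul (by norm_num), show 1/r * r = 1 by field_simp, Real.rpow_one,
    ← Real.rpow_natCast, ← Real.rpow_mul (by norm_num), show (m:ℝ)/2 * r = m * (r/2) by ring]
  ring

lemma tail_sum {Ω : Type*} [MeasurableSpace Ω] {μ : Measure Ω} [IsProbabilityMeasure μ]
    (r : ℝ) (hr : 2 < r) (X : ℕ → Ω → ℝ) (D : ℝ) (hD : 0 ≤ D) (hX : ∀ k, Measurable (X k))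
    (hb : ∀ m : ℕ, ∫⁻ ω, gMax X m ω ^ r ∂μ ≤ ENNReal.ofReal (D * (2^m : ℝ) ^ (r/2)))
    (z ε : ℝ) (hz : 0 < z) (hε : 0 < ε) :
    μ {ω | ∃ k : ℕ, 1 ≤ k ∧ (z + ε * k) / 8 ≤ |X k ω|} ≤ ENNReal.ofReal (32 ^ r * D * (z * ε) ^ (-(r/2))) := by
  have hr0 : 0 < r := by linarith
  have hsub : {ω | ∃ k : ℕ, 1 ≤ k ∧ (z + ε * k) / 8 ≤ |X k ω|} ⊆
      ⋃ m : ℕ, {ω | ENNReal.ofReal (((z + ε * 2^m)/8) ^ r) ≤ gMax X (m+1) ω ^ r} := by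
    rintro ω ⟨k, hk, hle⟩
    refine Set.mem_iUnion.2 ⟨Nat.log 2 k, ?_⟩
    have h1 : 2 ^ (Nat.log 2 k) ≤ k := Nat.pow_log_le_self 2 (by omega)
    have h2 : k < 2 ^ (Nat.log 2 k + 1) := Nat.lt_pow_succ_log_self (by norm_num) k
    have h3 := le_gMax X (Nat.log 2 k + 1) k h2.le ω
    simp only [Set.mem_ofPred_eq]
    rw [← ofReal_rpow' _ _ (by positivity) hr0.le]
    refine ENNReal.rpow_le_rpow (le_trans (ENNReal.ofReal_le_ofReal (le_trans ?_ hle)) h3) hr0.le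
    have : ((2:ℝ) ^ (Nat.log 2 k)) ≤ k := by exact_mod_cast h1
    have := mul_le_mul_of_nonneg_left this hε.le
    linarith
  set u : ℕ → ℝ := fun m => ε * 2^m / z with hu
  have hu0 : ∀ m, 0 < u m := fun m => by simp only [hu]; positivity
  set C : ℝ := 32 ^ r * D * (z * ε) ^ (-(r/2)) with hC
  have hC0 : 0 ≤ C := by positivity
  have hterm : ∀ m : ℕ, μ {ω | ENNReal.ofReal (((z + ε * 2^m)/8) ^ r) ≤ gMax X (m+1) ω ^ r} ≤
      ENNReal.ofReal (C * (1/(1+u m) - 1/(1+u (m+1)))) := by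
    intro m
    have hc : 0 < ((z + ε * 2^m)/8) ^ r := by positivity
    have h1 := meas_ge_le_lintegral_div (μ := μ) (((measurable_gMax X hX (m+1)).pow_const r).aemeasurable)
      (ε := ENNReal.ofReal (((z + ε * 2^m)/8) ^ r)) (by simpa using hc) ENNReal.ofReal_ne_top
    refine h1.trans ?_
    refine (ENNReal.div_le_div_right (hb (m+1)) _).trans ?_
    rw [← ENNReal.ofReal_div_of_pos hc]
    apply ENNReal.ofReal_le_ofReal
    have e1 : D * ((2:ℝ)^(m+1)) ^ (r/2) / ((z + ε * 2^m)/8) ^ r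
        = 8 ^ r * 2 ^ (r/2) * D * (z*ε) ^ (-(r/2)) * (u m / (1 + u m)^2) ^ (r/2) := by
      have e2 : u m / (1+u m)^2 = (2:ℝ)^m * (z * ε) / (z + ε * 2^m)^2 := by
        simp only [hu]; field_simp
      rw [e2, Real.div_rpow (by positivity) (by positivity), Real.div_rpow (by positivity) (by positivity),
        Real.mul_rpow (x := (2:ℝ)^m) (y := z * ε) (by positivity) (by positivity),
        Real.rpow_neg (x := z * ε) (by positivity),
        pow_succ, Real.mul_rpow (x := (2:ℝ)^m) (y := 2) (by positivity) (by positivity)]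
      have e3 : ((z + ε * 2^m)^2) ^ (r/2) = (z + ε * 2^m) ^ r := by
        rw [← Real.rpow_natCast, ← Real.rpow_mul (by positivity)]; congr 1; push_cast; ring
      rw [e3]
      have : (z*ε) ^ (r/2) ≠ 0 := by positivity
      have : (z + ε * 2^m) ^ r ≠ 0 := by positivity
      have : (8:ℝ) ^ r ≠ 0 := by positivity
      generalize (z*ε) ^ (r/2) = a1 at *
      generalize (z + ε * 2^m) ^ r = a2 at *
      generalize (8:ℝ) ^ r = a3 at *
      generalize ((2:ℝ)^m) ^ (r/2) = a4 at *
      generalize (2:ℝ) ^ (r/2) = a5 at *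
      field_simp
    rw [e1]
    have h2 : (u m / (1 + u m)^2) ^ (r/2) ≤ 2 * (1/(1+u m) - 1/(1+u (m+1))) := by
      have hum := hu0 m
      have e4 : u (m+1) = 2 * u m := by simp only [hu]; ring
      calc (u m / (1 + u m)^2) ^ (r/2) ≤ (u m / (1+u m)^2) ^ (1:ℝ) := by
            apply Real.rpow_le_rpow_of_exponent_ge (by positivity) _ (by linarith)
            rw [div_le_one (by positivity)]; nlinarith
        _ = u m / (1+u m)^2 := Real.rpow_one _
        _ ≤ _ := by
            rw [e4, div_sub_div _ _ (by positivity) (by positivity), ← mul_div_assoc, div_le_div_iff₀ (by positivity) (by positivity)]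
            have : 0 ≤ (u m) * (1 + u m) := by positivity
            nlinarith [mul_nonneg this hum.le]
    have h3 : (0:ℝ) ≤ 1/(1+u m) - 1/(1+u (m+1)) := by
      have h4 : 0 ≤ (u m / (1 + u m)^2) ^ (r/2) := by have := hu0 m; positivity
      linarith
    have h5 : (8:ℝ) ^ r * 2 ^ (r/2) * 2 ≤ 32 ^ r := by
      have a1 : (2:ℝ) ^ (r/2) ≤ 2 ^ r := Real.rpow_le_rpow_of_exponent_le (by norm_num) (by linarith)
      have a2 : (2:ℝ) ≤ 2 ^ r := by
        calc (2:ℝ) = 2 ^ (1:ℝ) := by simp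
          _ ≤ _ := Real.rpow_le_rpow_of_exponent_le (by norm_num) (by linarith)
      have a3 : (32:ℝ) ^ r = 8 ^ r * 2 ^ r * 2 ^ r := by
        rw [← Real.mul_rpow (by norm_num) (by norm_num), ← Real.mul_rpow (by norm_num) (by norm_num)]; norm_num
      rw [a3]
      gcongr
    calc 8 ^ r * 2 ^ (r/2) * D * (z*ε) ^ (-(r/2)) * (u m / (1 + u m)^2) ^ (r/2)
        ≤ 8 ^ r * 2 ^ (r/2) * D * (z*ε) ^ (-(r/2)) * (2 * (1/(1+u m) - 1/(1+u (m+1)))) := by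
          gcongr
      _ = (8 ^ r * 2 ^ (r/2) * 2) * (D * (z*ε) ^ (-(r/2)) * (1/(1+u m) - 1/(1+u (m+1)))) := by ring
      _ ≤ 32 ^ r * (D * (z*ε) ^ (-(r/2)) * (1/(1+u m) - 1/(1+u (m+1)))) := by
          apply mul_le_mul_of_nonneg_right h5
          have : 0 ≤ (z*ε) ^ (-(r/2)) := by positivity
          exact mul_nonneg (mul_nonneg hD this) h3
      _ = _ := by rw [hC]; ring
  refine (measure_mono hsub).trans ((measure_iUnion_le _).trans ?_)
  refine (ENNReal.tsum_le_tsum hterm).trans ?_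
  have hnn : ∀ m, 0 ≤ C * (1/(1+u m) - 1/(1+u (m+1))) := by
    intro m
    apply mul_nonneg hC0
    have : u m ≤ u (m+1) := by
      have := hu0 m
      have e4 : u (m+1) = 2 * u m := by simp only [hu]; ring
      linarith
    have := one_div_le_one_div_of_le (by linarith [hu0 m] : 0 < 1 + u m) (by linarith : 1 + u m ≤ 1 + u (m+1))
    linarith
  rw [ENNReal.tsum_eq_iSup_nat]
  refine iSup_le fun n => ?_
  rw [← ENNReal.ofReal_sum_of_nonneg (fun m _ => hnn m)]
  apply ENNReal.ofReal_le_ofReal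
  rw [← Finset.mul_sum, Finset.sum_range_sub' (fun m => 1/(1+u m))]
  have a1 : 0 ≤ 1/(1+u n) := by have := hu0 n; positivity
  have a2 : 1/(1+u 0) ≤ 1 := by
    rw [div_le_one (by linarith [hu0 0])]; linarith [hu0 0]
  have : 1/(1+u 0) - 1/(1+u n) ≤ 1 := by linarith
  nlinarith

/-- measurable version of the renewal count -/
noncomputable def cnt (a : ℕ → ℝ) (t : ℝ) : ℝ≥0∞ :=
  ∑' m : ℕ, if ∑ i ∈ Finset.range (m+1), a i ≤ t then 1 else 0

lemma measurable_cnt (t : ℝ) : Measurable (fun a : ℕ → ℝ => cnt a t) := by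
  unfold cnt
  refine Measurable.tsum fun m => ?_
  refine Measurable.ite ?_ measurable_const measurable_const
  exact measurableSet_le (by fun_prop) measurable_const

lemma psum_mono (a : ℕ → ℝ) (ha : ∀ i, 0 ≤ a i) : Monotone (fun n => ∑ i ∈ Finset.range n, a i) :=
  monotone_nat_of_le_succ (fun n => by rw [Finset.sum_range_succ]; linarith [ha n])

lemma cnt_spec (a : ℕ → ℝ) (ha : ∀ i, 0 ≤ a i) (t : ℝ) (ht : 0 ≤ t) (hf : cnt a t ≠ ∞) :
    ∃ n : ℕ, cnt a t = n ∧ ∀ m, (∑ i ∈ Finset.range m, a i ≤ t ↔ m ≤ n) := by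
  classical
  have hmono := psum_mono a ha
  have hex : ∃ n, ¬ (∑ i ∈ Finset.range (n+1), a i ≤ t) := by
    by_contra hcon
    push Not at hcon
    apply hf
    unfold cnt
    simp only [hcon, if_true]
    exact ENNReal.tsum_const_eq_top_of_ne_zero (by simp)
  obtain ⟨n, hn, hmin⟩ : ∃ n, ¬ (∑ i ∈ Finset.range (n+1), a i ≤ t) ∧
      ∀ m < n, (∑ i ∈ Finset.range (m+1), a i ≤ t) :=
    ⟨Nat.find hex, Nat.find_spec hex, fun m hm => not_not.1 (Nat.find_min hex hm)⟩
  have key : ∀ m, (∑ i ∈ Finset.range m, a i ≤ t ↔ m ≤ n) := by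
    intro m
    constructor
    · intro h
      by_contra hlt
      push Not at hlt
      exact hn (le_trans (hmono (show n + 1 ≤ m from hlt)) h)
    · intro h
      rcases m with _ | m
      · simpa using ht
      · exact hmin m (by omega)
  refine ⟨n, ?_, key⟩
  unfold cnt
  simp only [key]
  rw [tsum_eq_sum (s := Finset.range n)]
  · rw [Finset.sum_congr rfl (g := fun _ => (1:ℝ≥0∞))]
    · simp
    · intro m hm
      rw [Finset.mem_range] at hm
      rw [if_pos (by omega)]
  · intro m hm
    rw [Finset.mem_range] at hm
    rw [if_neg (by omega)]

lemma renewalCount_eq_of_spec (a : ℕ → ℝ) (t : ℝ) (n : ℕ) (h : ∀ m, (∑ i ∈ Finset.range m, a i ≤ t ↔ m ≤ n)) :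
    renewalCount a t = n := by
  unfold renewalCount
  have : {m : ℕ | ∑ i ∈ Finset.range m, a i ≤ t} = Set.Iic n := by
    ext m; simp [h]
  rw [this, csSup_Iic]

lemma cnt_mono (a : ℕ → ℝ) {s t : ℝ} (hst : s ≤ t) : cnt a s ≤ cnt a t := by
  unfold cnt
  refine ENNReal.tsum_le_tsum fun m => ?_
  split_ifs with h1 h2
  · exact le_rfl
  · exact absurd (h1.trans hst) h2
  · simp
  · exact le_rfl

/-- equilibrium renewal process data (intervals everywhere nonnegative) -/
structure EqRen {Ω : Type*} [MeasurableSpace Ω] (μ : Measure Ω) (S : Ω → ℝ) (x : ℕ → Ω → ℝ) : Prop where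
  meas : ∀ j, Measurable (x j)
  nn : ∀ j ω, 0 ≤ x j ω
  ind : iIndepFun x μ
  law : ∀ j, μ.map (x (j+1)) = μ.map S
  Smeas : Measurable S
  Snn : ∀ ω, 0 ≤ S ω
  Sint : Integrable S μ
  ES : ∫ ω, S ω ∂μ = 1
  eq : ∀ y : ℝ, 0 ≤ y → (μ {ω | y < x 0 ω}).toReal = ∫ z in Set.Ioi y, (μ {ω | z < S ω}).toReal

/-- partial sums `x m + ... + x (m+k-1)` -/
noncomputable def blk {Ω : Type*} (x : ℕ → Ω → ℝ) (m k : ℕ) (ω : Ω) : ℝ := ∑ i ∈ Finset.range k, x (m+i) ω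

lemma measurable_blk {Ω : Type*} [MeasurableSpace Ω] (x : ℕ → Ω → ℝ) (hx : ∀ j, Measurable (x j)) (m k : ℕ) :
    Measurable (blk x m k) := by
  unfold blk; fun_prop

lemma indep_sums {Ω : Type*} [MeasurableSpace Ω] {μ : Measure Ω} (x : ℕ → Ω → ℝ)
    (hx : ∀ j, Measurable (x j)) (hind : iIndepFun x μ) (s t : Finset ℕ) (hst : Disjoint s t) :
    IndepFun (fun ω => ∑ i ∈ s, x i ω) (fun ω => ∑ i ∈ t, x i ω) μ := by
  have h := hind.indepFun_finset s t hst hx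
  have h2 := h.comp (φ := fun f : s → ℝ => ∑ i, f i) (ψ := fun f : t → ℝ => ∑ i, f i) (by fun_prop) (by fun_prop)
  convert h2 using 1
  · ext ω; exact (Finset.sum_coe_sort s (fun i => x i ω)).symm
  · ext ω; exact (Finset.sum_coe_sort t (fun i => x i ω)).symm

lemma blk_eq {Ω : Type*} (x : ℕ → Ω → ℝ) (m k : ℕ) (ω : Ω) : blk x m k ω = ∑ i ∈ Finset.Ico m (m+k), x i ω := by
  rw [Finset.sum_Ico_eq_sum_range]; simp [blk]

lemma indep_blk {Ω : Type*} [MeasurableSpace Ω] {μ : Measure Ω} (x : ℕ → Ω → ℝ)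
    (hx : ∀ j, Measurable (x j)) (hind : iIndepFun x μ) (m k m' k' : ℕ) (h : m + k ≤ m') :
    IndepFun (blk x m k) (blk x m' k') μ := by
  have := indep_sums x hx hind (Finset.Ico m (m+k)) (Finset.Ico m' (m'+k')) (by
    rw [Finset.disjoint_left]; intro i hi hi'; rw [Finset.mem_Ico] at hi hi'; omega)
  convert this using 1
  · ext ω; exact blk_eq x m k ω
  · ext ω; exact blk_eq x m' k' ω

lemma blk_add {Ω : Type*} (x : ℕ → Ω → ℝ) (m k l : ℕ) (ω : Ω) : blk x m (k+l) ω = blk x m k ω + blk x (m+k) l ω := by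
  unfold blk; rw [Finset.sum_range_add]; simp [add_assoc]

lemma blk_one {Ω : Type*} (x : ℕ → Ω → ℝ) (m : ℕ) (ω : Ω) : blk x m 1 ω = x m ω := by simp [blk]

lemma blk_zero {Ω : Type*} (x : ℕ → Ω → ℝ) (m : ℕ) (ω : Ω) : blk x m 0 ω = 0 := by simp [blk]

lemma blk_nn {Ω : Type*} (x : ℕ → Ω → ℝ) (hx : ∀ j ω, 0 ≤ x j ω) (m k : ℕ) (ω : Ω) : 0 ≤ blk x m k ω :=
  Finset.sum_nonneg fun i _ => hx _ _

/-- integrate out an independent pair -/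
lemma lintegral_indep {Ω : Type*} [MeasurableSpace Ω] {μ : Measure Ω} [IsProbabilityMeasure μ] (X Y : Ω → ℝ)
    (hX : Measurable X) (hY : Measurable Y) (h : IndepFun X Y μ) (f : ℝ → ℝ → ℝ≥0∞) (hf : Measurable (Function.uncurry f)) :
    ∫⁻ ω, f (X ω) (Y ω) ∂μ = ∫⁻ ω', ∫⁻ ω, f (X ω) (Y ω') ∂μ ∂μ := by
  have h1 := (indepFun_iff_map_prod_eq_prod_map_map hX.aemeasurable hY.aemeasurable).1 h
  have : IsProbabilityMeasure (μ.map X) := Measure.isProbabilityMeasure_map hX.aemeasurable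
  have : IsProbabilityMeasure (μ.map Y) := Measure.isProbabilityMeasure_map hY.aemeasurable
  calc ∫⁻ ω, f (X ω) (Y ω) ∂μ = ∫⁻ p, Function.uncurry f p ∂(μ.map (fun ω => (X ω, Y ω))) := by
        rw [lintegral_map hf (by fun_prop)]; rfl
    _ = ∫⁻ y, ∫⁻ x, f x y ∂(μ.map X) ∂(μ.map Y) := by
        rw [h1, lintegral_prod_symm _ hf.aemeasurable]; rfl
    _ = _ := by
        rw [lintegral_map (f := fun y => ∫⁻ x, f x y ∂(μ.map X)) (hf.lintegral_prod_left') hY]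
        refine lintegral_congr fun ω' => ?_
        exact lintegral_map (hf.comp (by fun_prop : Measurable fun x : ℝ => (x, Y ω'))) hX

lemma EqRen.map_blk {Ω : Type*} [MeasurableSpace Ω] {μ : Measure Ω} [IsProbabilityMeasure μ] {S : Ω → ℝ} {x : ℕ → Ω → ℝ}
    (h : EqRen μ S x) (m k : ℕ) : μ.map (blk x (m+1) k) = μ.map (blk x 1 k) := by
  induction k with
  | zero => congr 1
  | succ k ih =>
    have e : ∀ m, μ.map (blk x (m+1) (k+1)) = (μ.map (blk x (m+1) k)).conv (μ.map S) := by
      intro m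
      have e1 : blk x (m+1) (k+1) = blk x (m+1) k + x (m+1+k) := by
        ext ω; simp [blk_add, blk_one]
      have e2 : IndepFun (blk x (m+1) k) (x (m+1+k)) μ := by
        have := indep_blk x h.meas h.ind (m+1) k (m+1+k) 1 le_rfl
        rwa [show blk x (m+1+k) 1 = x (m+1+k) from funext fun ω => blk_one _ _ _] at this
      rw [e1, e2.map_add_eq_map_conv_map₀ (measurable_blk x h.meas _ _).aemeasurable (h.meas _).aemeasurable]
      rw [show m+1+k = (m+k)+1 by ring, h.law]
    rw [e, ih, ← e 0]

lemma EqRen.lint_blk {Ω : Type*} [MeasurableSpace Ω] {μ : Measure Ω} [IsProbabilityMeasure μ] {S : Ω → ℝ} {x : ℕ → Ω → ℝ}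
    (h : EqRen μ S x) (m k : ℕ) (f : ℝ → ℝ≥0∞) (hf : Measurable f) :
    ∫⁻ ω, f (blk x (m+1) k ω) ∂μ = ∫⁻ ω, f (blk x 1 k ω) ∂μ := by
  rw [← lintegral_map hf (measurable_blk x h.meas _ _), h.map_blk, lintegral_map hf (measurable_blk x h.meas _ _)]

lemma EqRen.lint_S {Ω : Type*} [MeasurableSpace Ω] {μ : Measure Ω} [IsProbabilityMeasure μ] {S : Ω → ℝ} {x : ℕ → Ω → ℝ}
    (h : EqRen μ S x) (m : ℕ) (f : ℝ → ℝ≥0∞) (hf : Measurable f) :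
    ∫⁻ ω, f (x (m+1) ω) ∂μ = ∫⁻ ω, f (S ω) ∂μ := by
  rw [← lintegral_map hf (h.meas _), h.law, lintegral_map hf h.Smeas]

lemma EqRen.x0 {Ω : Type*} [MeasurableSpace Ω] {μ : Measure Ω} [IsProbabilityMeasure μ] {S : Ω → ℝ} {x : ℕ → Ω → ℝ}
    (h : EqRen μ S x) (u : ℝ) :
    μ {ω | x 0 ω ≤ u} + ∫⁻ ω, ENNReal.ofReal (u - S ω) ∂μ = ENNReal.ofReal u := by
  rcases lt_or_ge u 0 with hu | hu
  · have e1 : {ω | x 0 ω ≤ u} = ∅ := by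
      ext ω; simp; linarith [h.nn 0 ω]
    have e2 : ∀ ω, ENNReal.ofReal (u - S ω) = 0 := fun ω => ENNReal.ofReal_of_nonpos (by linarith [h.Snn ω])
    simp [e1, e2, ENNReal.ofReal_of_nonpos hu.le]
  · have hm : MeasurableSet {ω | x 0 ω ≤ u} := measurableSet_le (h.meas 0) measurable_const
    have h1 : (μ {ω | x 0 ω ≤ u}).toReal = 1 - (μ {ω | u < x 0 ω}).toReal := by
      have : {ω | u < x 0 ω} = {ω | x 0 ω ≤ u}ᶜ := by ext ω; simp
      rw [this]
      have := probReal_compl_eq_one_sub (μ := μ) hm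
      simp only [Measure.real] at this
      linarith
    have hi : Integrable (fun ω => max (S ω - u) 0) μ := (h.Sint.sub (integrable_const u)).pos_part
    have hi2 : Integrable (fun ω => max (u - S ω) 0) μ := ((integrable_const u).sub h.Sint).pos_part
    have h2 : ∫ z in Set.Ioi u, (μ {ω | z < S ω}).toReal = ∫ ω, max (S ω - u) 0 ∂μ := by
      rw [hi.integral_eq_integral_meas_lt (Filter.Eventually.of_forall fun ω => le_max_right _ _)]
      have e3 : ∫ z in Set.Ioi u, (μ {ω | z < S ω}).toReal = ∫ z in Set.Ioi (0:ℝ), (μ {ω | z + u < S ω}).toReal := by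
        have := (measurePreserving_add_right (volume : Measure ℝ) u).setIntegral_preimage_emb
          (MeasurableEquiv.addRight u).measurableEmbedding (fun z => (μ {ω | z < S ω}).toReal) (Set.Ioi u)
        rw [← this]
        congr 2
        ext z; simp
      rw [e3]
      refine setIntegral_congr_fun measurableSet_Ioi fun t ht => ?_
      have : {ω | t + u < S ω} = {ω | t < max (S ω - u) 0} := by
        ext ω
        have ht' : (0:ℝ) < t := ht
        simp only [Set.mem_ofPred_eq, lt_max_iff]
        constructor
        · intro h; left; linarith
        · rintro (h | h) <;> linarith
      simp only [this, Measure.real]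
    have h3 : ∫ ω, max (u - S ω) 0 ∂μ = u - 1 + ∫ ω, max (S ω - u) 0 ∂μ := by
      have : ∀ ω, max (u - S ω) 0 = (u - S ω) + max (S ω - u) 0 := by
        intro ω
        rcases le_total (S ω) u with h | h
        · rw [max_eq_left (by linarith), max_eq_right (by linarith)]; ring
        · rw [max_eq_right (by linarith), max_eq_left (by linarith)]; ring
      simp only [this]
      have hi3 : Integrable (fun ω => u - S ω) μ := (integrable_const u).sub h.Sint
      rw [integral_add hi3 hi, integral_sub (integrable_const u) h.Sint, h.ES]
      simp
    have h4 : ∫⁻ ω, ENNReal.ofReal (u - S ω) ∂μ = ENNReal.ofReal (∫ ω, max (u - S ω) 0 ∂μ) := by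
      rw [ofReal_integral_eq_lintegral_ofReal hi2 (Filter.Eventually.of_forall fun ω => le_max_right _ _)]
      refine lintegral_congr fun ω => ?_
      simp
    have h5 : 0 ≤ ∫ ω, max (u - S ω) 0 ∂μ := integral_nonneg fun ω => le_max_right _ _
    rw [h4, ← ENNReal.ofReal_toReal (measure_ne_top μ {ω | x 0 ω ≤ u}),
      ← ENNReal.ofReal_add ENNReal.toReal_nonneg h5, h1, h.eq u hu, h2, h3]
    congr 1; ring

lemma EqRen.FH {Ω : Type*} [MeasurableSpace Ω] {μ : Measure Ω} [IsProbabilityMeasure μ] {S : Ω → ℝ} {x : ℕ → Ω → ℝ}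
    (h : EqRen μ S x) (k : ℕ) (t : ℝ) :
    μ {ω | blk x 0 (k+1) ω ≤ t} + ∫⁻ ω, ENNReal.ofReal (t - blk x 1 (k+1) ω) ∂μ
      = ∫⁻ ω, ENNReal.ofReal (t - blk x 1 k ω) ∂μ := by
  have mV := measurable_blk x h.meas 1 k
  have i1 : IndepFun (x 0) (blk x 1 k) μ := by
    have := indep_blk x h.meas h.ind 0 1 1 k le_rfl
    rwa [show blk x 0 1 = x 0 from funext fun ω => blk_one _ _ _] at this
  have i2 : IndepFun (x (k+1)) (blk x 1 k) μ := by
    have := (indep_blk x h.meas h.ind 1 k (k+1) 1 (by omega)).symm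
    rwa [show blk x (k+1) 1 = x (k+1) from funext fun ω => blk_one _ _ _] at this
  have e1 : μ {ω | blk x 0 (k+1) ω ≤ t} = ∫⁻ ω', μ {ω | x 0 ω ≤ t - blk x 1 k ω'} ∂μ := by
    have hm : MeasurableSet {ω | blk x 0 (k+1) ω ≤ t} := measurableSet_le (measurable_blk x h.meas _ _) measurable_const
    rw [← lintegral_indicator_one hm]
    have := lintegral_indep (μ := μ) (x 0) (blk x 1 k) (h.meas 0) mV i1
      (fun a b => if a ≤ t - b then 1 else 0) (by
        refine Measurable.ite (measurableSet_le measurable_fst (by fun_prop)) measurable_const measurable_const)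
    convert this using 1
    · refine lintegral_congr fun ω => ?_
      simp only [Set.indicator_apply, Set.mem_ofPred_eq, Pi.one_apply]
      rw [show k + 1 = 1 + k by ring, blk_add, blk_one]
      simp only [zero_add, le_sub_iff_add_le]
    · refine lintegral_congr fun ω' => ?_
      rw [← lintegral_indicator_one (measurableSet_le (h.meas 0) measurable_const)]
      refine lintegral_congr fun ω => ?_
      simp [Set.indicator_apply]
  have e2 : ∫⁻ ω, ENNReal.ofReal (t - blk x 1 (k+1) ω) ∂μ
      = ∫⁻ ω', ∫⁻ ω, ENNReal.ofReal (t - blk x 1 k ω' - S ω) ∂μ ∂μ := by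
    have := lintegral_indep (μ := μ) (x (k+1)) (blk x 1 k) (h.meas _) mV i2
      (fun a b => ENNReal.ofReal (t - b - a)) (by unfold Function.uncurry; fun_prop)
    rw [show (fun ω => ENNReal.ofReal (t - blk x 1 (k+1) ω)) = fun ω => ENNReal.ofReal (t - blk x 1 k ω - x (k+1) ω) from ?_, this]
    · refine lintegral_congr fun ω' => ?_
      exact h.lint_S k (fun a => ENNReal.ofReal (t - blk x 1 k ω' - a)) (by fun_prop)
    · ext ω; rw [blk_add, blk_one, add_comm 1 k]; congr 1; ring
  rw [e1, e2, ← lintegral_add_right' _ ?_]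
  · exact lintegral_congr fun ω' => h.x0 _
  · apply Measurable.aemeasurable
    have : Measurable (Function.uncurry fun ω' ω => ENNReal.ofReal (t - blk x 1 k ω' - S ω)) := by
      have := h.Smeas
      unfold Function.uncurry; fun_prop
    exact this.lintegral_prod_right'

lemma EqRen.V_exp {Ω : Type*} [MeasurableSpace Ω] {μ : Measure Ω} [IsProbabilityMeasure μ] {S : Ω → ℝ} {x : ℕ → Ω → ℝ}
    (h : EqRen μ S x) (h2 : Integrable (fun ω => S ω ^ 2) μ) (b : ℝ) (hb : b = ∫ ω, S ω ^ 2 ∂μ) (hb1 : 1 ≤ b) (k : ℕ) (t : ℝ) :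
    μ {ω | blk x 1 k ω ≤ t} ≤ ENNReal.ofReal (Real.exp ((t - k/2) / (2*b))) := by
  set l : ℝ := 1/(2*b) with hl
  have hl0 : 0 < l := by positivity
  have hInt : ∀ X : Ω → ℝ, Measurable X → (∀ ω, 0 ≤ X ω) → Integrable (fun ω => Real.exp (-l * X ω)) μ := by
    intro X hX hn
    refine Integrable.of_bound (by fun_prop) 1 (Filter.Eventually.of_forall fun ω => ?_)
    rw [Real.norm_eq_abs, abs_of_pos (Real.exp_pos _)]
    apply Real.exp_le_one_iff.2
    have := mul_nonneg hl0.le (hn ω)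
    linarith
  have hS : mgf S μ (-l) ≤ Real.exp (-(l/2)) := by
    have h3 : mgf S μ (-l) ≤ ∫ ω, (1 - l * S ω + l^2 * S ω ^ 2) ∂μ := by
      unfold mgf
      refine integral_mono (hInt S h.Smeas h.Snn) ?_ fun ω => ?_
      · exact ((integrable_const _).sub (h.Sint.const_mul l)).add (h2.const_mul _)
      · set y := l * S ω with hy
        have hy0 : 0 ≤ y := mul_nonneg hl0.le (h.Snn ω)
        have a1 : Real.exp (-l * S ω) * Real.exp y = 1 := by
          rw [← Real.exp_add]; simp [hy]
        have a2 := Real.add_one_le_exp y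
        have a3 := Real.exp_pos (-l * S ω)
        show Real.exp (-l * S ω) ≤ 1 - y + l^2 * S ω^2
        have a4 : l^2 * S ω^2 = y^2 := by rw [hy]; ring
        rw [a4]
        have a5 : Real.exp (-l * S ω) * (y+1) ≤ 1 := (mul_le_mul_of_nonneg_left a2 a3.le).trans a1.le
        nlinarith [mul_nonneg hy0 (sq_nonneg y), mul_nonneg hy0 hy0]
    have h4 : ∫ ω, (1 - l * S ω + l^2 * S ω ^ 2) ∂μ = 1 - l/2 := by
      have hi3 : Integrable (fun ω => 1 - l * S ω) μ := (integrable_const _).sub (h.Sint.const_mul l)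
      rw [integral_add hi3 (h2.const_mul _), integral_sub (integrable_const _) (h.Sint.const_mul l),
        integral_const_mul, integral_const_mul, h.ES, ← hb]
      simp only [integral_const, probReal_univ, smul_eq_mul, mul_one, hl]
      field_simp; ring
    have h5 := Real.add_one_le_exp (-(l/2))
    linarith
  have hm : mgf (blk x 1 k) μ (-l) ≤ Real.exp (-(l/2)) ^ k := by
    have hind : iIndepFun (fun i => x (1+i)) μ := h.ind.precomp (fun a b hab => by simpa using hab)
    have e := hind.mgf_sum (t := -l) (fun i => h.meas (1+i)) (Finset.range k)
    have e2 : blk x 1 k = ∑ i ∈ Finset.range k, x (1+i) := by ext ω; simp [blk]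
    rw [e2, e]
    calc ∏ i ∈ Finset.range k, mgf (x (1+i)) μ (-l) ≤ ∏ i ∈ Finset.range k, Real.exp (-(l/2)) := by
          refine Finset.prod_le_prod (fun i _ => mgf_nonneg) fun i _ => ?_
          have : mgf (x (1+i)) μ (-l) = mgf S μ (-l) := by
            unfold mgf
            rw [← integral_map (φ := x (1+i)) (f := fun y => Real.exp (-l * y)) (h.meas _).aemeasurable (by fun_prop),
              add_comm 1 i, h.law, integral_map h.Smeas.aemeasurable (by fun_prop)]
          rw [this]; exact hS
      _ = _ := by simp
  have hfin := measure_le_le_exp_mul_mgf (μ := μ) (X := blk x 1 k) t (t := -l) (by linarith)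
    (hInt _ (measurable_blk x h.meas 1 k) (blk_nn x h.nn 1 k))
  rw [← ENNReal.ofReal_toReal (measure_ne_top μ _)]
  apply ENNReal.ofReal_le_ofReal
  refine hfin.trans ((mul_le_mul_of_nonneg_left hm (Real.exp_pos _).le).trans (le_of_eq ?_))
  rw [← Real.exp_nat_mul, ← Real.exp_add]
  congr 1
  rw [hl]; field_simp; ring

lemma sum_poly_exp (p b : ℝ) (hp : 1 ≤ p) (hb : 1 ≤ b) :
    ∑' k : ℕ, ENNReal.ofReal (((k:ℝ)+1)^p * Real.exp (-(k:ℝ)/(8*b))) ≤ ENNReal.ofReal (40 * (16*p)^p * b^(p+1)) := by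
  set y : ℝ := 1/(16*b) with hy
  have hy0 : 0 < y := by positivity
  have hy1 : y ≤ 1/16 := by rw [hy]; apply one_div_le_one_div_of_le <;> linarith
  have key : ∀ k : ℕ, ((k:ℝ)+1)^p * Real.exp (-(k:ℝ)/(8*b)) ≤ (16*p*b)^p * Real.exp y * Real.exp (-y)^k := by
    intro k
    have a1 : ((k:ℝ)+1) ≤ (16*p*b) * Real.exp (y*(k+1)/p) := by
      have := Real.add_one_le_exp (y*(k+1)/p)
      have e : ((k:ℝ)+1) = (16*p*b) * (y*(k+1)/p) := by rw [hy]; field_simp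
      calc ((k:ℝ)+1) = (16*p*b) * (y*(k+1)/p) := e
        _ ≤ _ := by gcongr; linarith
    have a2 : ((k:ℝ)+1)^p ≤ (16*p*b)^p * Real.exp (y*(k+1)) := by
      calc ((k:ℝ)+1)^p ≤ ((16*p*b) * Real.exp (y*(k+1)/p))^p := by gcongr
        _ = _ := by
          rw [Real.mul_rpow (by positivity) (by positivity), ← Real.exp_mul]; congr 2; field_simp
    calc ((k:ℝ)+1)^p * Real.exp (-(k:ℝ)/(8*b)) ≤ ((16*p*b)^p * Real.exp (y*(k+1))) * Real.exp (-(k:ℝ)/(8*b)) := by gcongr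
      _ = _ := by
        rw [← Real.exp_nat_mul, mul_assoc ((16*p*b)^p), mul_assoc ((16*p*b)^p), ← Real.exp_add, ← Real.exp_add]
        congr 2; rw [hy]; field_simp; ring
  refine (ENNReal.tsum_le_tsum fun k => ENNReal.ofReal_le_ofReal (key k)).trans ?_
  have hg : Real.exp (-y) < 1 := Real.exp_lt_one_iff.2 (by linarith)
  have hs := hasSum_geometric_of_lt_one (Real.exp_pos (-y)).le hg
  have hs2 := hs.mul_left ((16*p*b)^p * Real.exp y)
  rw [← ENNReal.ofReal_tsum_of_nonneg (fun k => by positivity) hs2.summable, hs2.tsum_eq]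
  apply ENNReal.ofReal_le_ofReal
  have c1 : Real.exp y ≤ 2 := by
    have : Real.exp y ≤ Real.exp (1/2) := Real.exp_le_exp.2 (by linarith)
    have h2 : Real.exp (1/2) ^ 2 = Real.exp 1 := by rw [← Real.exp_nat_mul]; norm_num
    nlinarith [Real.exp_one_lt_d9, Real.exp_pos (1/2)]
  have c2 : (1 - Real.exp (-y))⁻¹ ≤ 20 * b := by
    rw [inv_le_comm₀ (by linarith) (by positivity)]
    have h3 := Real.add_one_le_exp y
    have h4 : Real.exp (-y) * Real.exp y = 1 := by rw [← Real.exp_add]; simp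
    have h5 : Real.exp (-y) * (y+1) ≤ 1 := (mul_le_mul_of_nonneg_left h3 (Real.exp_pos _).le).trans h4.le
    have h6 : (20*b)⁻¹ = y * (16/20) := by rw [hy]; field_simp
    rw [h6]
    nlinarith [Real.exp_pos (-y)]
  calc (16*p*b)^p * Real.exp y * (1 - Real.exp (-y))⁻¹ ≤ (16*p*b)^p * 2 * (20*b) := by
        have : 0 < 1 - Real.exp (-y) := by linarith
        gcongr
    _ = _ := by
        rw [Real.mul_rpow (by positivity) (by positivity), Real.rpow_add (by positivity), Real.rpow_one]; ring

lemma EqRen.sumF {Ω : Type*} [MeasurableSpace Ω] {μ : Measure Ω} [IsProbabilityMeasure μ] {S : Ω → ℝ} {x : ℕ → Ω → ℝ}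
    (h : EqRen μ S x) (h2 : Integrable (fun ω => S ω ^ 2) μ) (hb1 : 1 ≤ ∫ ω, S ω ^ 2 ∂μ) (t : ℝ) :
    ∑' k : ℕ, μ {ω | blk x 0 (k+1) ω ≤ t} = ENNReal.ofReal t := by
  set H : ℕ → ℝ≥0∞ := fun k => ∫⁻ ω, ENNReal.ofReal (t - blk x 1 k ω) ∂μ with hH
  have h1 : ∀ n, ∑ k ∈ Finset.range n, μ {ω | blk x 0 (k+1) ω ≤ t} + H n = ENNReal.ofReal t := by
    intro n
    induction n with
    | zero => simp [hH, blk_zero]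
    | succ n ih =>
      rw [Finset.sum_range_succ, add_assoc, hH]
      simp only
      rw [h.FH n t]; exact ih
  have hle : ∀ n, H n ≤ ENNReal.ofReal t * μ {ω | blk x 1 n ω ≤ t} := by
    intro n
    rw [← lintegral_indicator_const (measurableSet_le (measurable_blk x h.meas _ _) measurable_const)]
    refine lintegral_mono fun ω => ?_
    simp only [Set.indicator_apply, Set.mem_ofPred_eq]
    split_ifs with hc
    · exact ENNReal.ofReal_le_ofReal (by linarith [blk_nn x h.nn 1 n ω])
    · rw [ENNReal.ofReal_of_nonpos (by linarith)]
  have hlim : Filter.Tendsto H Filter.atTop (nhds 0) := by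
    set b := ∫ ω, S ω ^ 2 ∂μ with hb
    have : ∀ n : ℕ, H n ≤ ENNReal.ofReal t * ENNReal.ofReal (Real.exp (t/(2*b)) * Real.exp (-(1/(4*b)))^n) := by
      intro n
      refine (hle n).trans ?_
      gcongr
      refine (h.V_exp h2 b hb hb1 n t).trans (ENNReal.ofReal_le_ofReal (le_of_eq ?_))
      rw [← Real.exp_nat_mul, ← Real.exp_add]; congr 1; field_simp; ring
    refine tendsto_of_tendsto_of_tendsto_of_le_of_le tendsto_const_nhds ?_ (fun n => zero_le) this
    have a1 : Filter.Tendsto (fun n : ℕ => Real.exp (t/(2*b)) * Real.exp (-(1/(4*b)))^n) Filter.atTop (nhds 0) := by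
      have := (tendsto_pow_atTop_nhds_zero_of_lt_one (Real.exp_pos (-(1/(4*b)))).le
        (Real.exp_lt_one_iff.2 (neg_lt_zero.2 (by positivity)))).const_mul (Real.exp (t/(2*b)))
      simpa using this
    have a2 := ENNReal.tendsto_ofReal a1
    rw [ENNReal.ofReal_zero] at a2
    have := ENNReal.Tendsto.const_mul (a := ENNReal.ofReal t) a2 (Or.inr ENNReal.ofReal_ne_top)
    simpa using this
  have hs := (ENNReal.summable (f := fun k : ℕ => μ {ω | blk x 0 (k+1) ω ≤ t})).hasSum.tendsto_sum_nat
  have := hs.add hlim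
  simp only [h1, add_zero] at this
  exact (tendsto_nhds_unique tendsto_const_nhds this).symm

/-- real valued counting variable -/
noncomputable def Nr {Ω : Type*} (x : ℕ → Ω → ℝ) (t : ℝ) (ω : Ω) : ℝ := (cnt (fun j => x j ω) t).toReal

lemma measurable_Nr {Ω : Type*} [MeasurableSpace Ω] (x : ℕ → Ω → ℝ) (hx : ∀ j, Measurable (x j)) (t : ℝ) :
    Measurable (Nr x t) :=
  ((measurable_cnt t).comp (measurable_pi_lambda _ hx)).ennreal_toReal

lemma psum_eq_blk {Ω : Type*} (x : ℕ → Ω → ℝ) (m : ℕ) (ω : Ω) : ∑ i ∈ Finset.range m, x i ω = blk x 0 m ω := by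
  simp [blk]

lemma EqRen.lint_cnt {Ω : Type*} [MeasurableSpace Ω] {μ : Measure Ω} [IsProbabilityMeasure μ] {S : Ω → ℝ} {x : ℕ → Ω → ℝ}
    (h : EqRen μ S x) (h2 : Integrable (fun ω => S ω ^ 2) μ) (hb1 : 1 ≤ ∫ ω, S ω ^ 2 ∂μ) (t : ℝ) :
    ∫⁻ ω, cnt (fun j => x j ω) t ∂μ = ENNReal.ofReal t := by
  rw [← h.sumF h2 hb1 t]
  unfold cnt
  have hm : ∀ m, MeasurableSet {ω | blk x 0 (m+1) ω ≤ t} := fun m => measurableSet_le (measurable_blk x h.meas _ _) measurable_const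
  rw [lintegral_tsum]
  · congr 1; ext m
    rw [← lintegral_indicator_one (hm m)]
    refine lintegral_congr fun ω => ?_
    simp only [psum_eq_blk, Set.indicator_apply, Set.mem_ofPred_eq, Pi.one_apply]
  · intro m
    simp only [psum_eq_blk]
    exact (Measurable.ite (hm m) measurable_const measurable_const).aemeasurable

lemma EqRen.good {Ω : Type*} [MeasurableSpace Ω] {μ : Measure Ω} [IsProbabilityMeasure μ] {S : Ω → ℝ} {x : ℕ → Ω → ℝ}
    (h : EqRen μ S x) (h2 : Integrable (fun ω => S ω ^ 2) μ) (hb1 : 1 ≤ ∫ ω, S ω ^ 2 ∂μ) :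
    ∀ᵐ ω ∂μ, ∀ t, cnt (fun j => x j ω) t ≠ ∞ := by
  have : ∀ n : ℕ, ∀ᵐ ω ∂μ, cnt (fun j => x j ω) n < ∞ := by
    intro n
    refine ae_lt_top ((measurable_cnt n).comp (measurable_pi_lambda _ h.meas)) ?_
    rw [h.lint_cnt h2 hb1]; exact ENNReal.ofReal_ne_top
  filter_upwards [ae_all_iff.2 this] with ω hω t
  obtain ⟨n, hn⟩ := exists_nat_ge t
  exact ((cnt_mono _ hn).trans_lt (hω n)).ne

lemma EqRen.spec {Ω : Type*} [MeasurableSpace Ω] {μ : Measure Ω} [IsProbabilityMeasure μ] {S : Ω → ℝ} {x : ℕ → Ω → ℝ}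
    (h : EqRen μ S x) (h2 : Integrable (fun ω => S ω ^ 2) μ) (hb1 : 1 ≤ ∫ ω, S ω ^ 2 ∂μ) :
    ∀ᵐ ω ∂μ, ∀ t, 0 ≤ t → ∃ n : ℕ, Nr x t ω = n ∧ renewalCount (fun j => x j ω) t = n ∧ ∀ m, (blk x 0 m ω ≤ t ↔ m ≤ n) := by
  filter_upwards [h.good h2 hb1] with ω hω t ht
  obtain ⟨n, hn, hs⟩ := cnt_spec (fun j => x j ω) (fun j => h.nn j ω) t ht (hω t)
  refine ⟨n, by simp [Nr, hn], renewalCount_eq_of_spec _ _ _ hs, fun m => ?_⟩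
  rw [← psum_eq_blk]; exact hs m

lemma EqRen.G {Ω : Type*} [MeasurableSpace Ω] {μ : Measure Ω} [IsProbabilityMeasure μ] {S : Ω → ℝ} {x : ℕ → Ω → ℝ}
    (h : EqRen μ S x) (h2 : Integrable (fun ω => S ω ^ 2) μ) (hb1 : 1 ≤ ∫ ω, S ω ^ 2 ∂μ) (k : ℕ) (s t : ℝ) (hs : 0 ≤ s) :
    ∑' m : ℕ, μ {ω | blk x 0 (m+1) ω ≤ s ∧ blk x 0 (m+1+k) ω ≤ s + t} + ∫⁻ ω, ENNReal.ofReal (t - blk x 1 k ω) ∂μ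
      = ∫⁻ ω, ENNReal.ofReal (s + t - blk x 1 k ω) ∂μ := by
  have mb := measurable_blk x h.meas
  have meas1 : ∀ m, Measurable (fun v : ℝ => μ {ω | blk x 0 (m+1) ω ≤ min s (s + t - v)}) := by
    intro m
    have : Measurable (fun u : ℝ => μ {ω | blk x 0 (m+1) ω ≤ u}) := by
      apply Monotone.measurable
      intro u u' huu
      exact measure_mono fun ω hω => le_trans hω huu
    exact this.comp (by fun_prop)
  have e1 : ∀ m : ℕ, μ {ω | blk x 0 (m+1) ω ≤ s ∧ blk x 0 (m+1+k) ω ≤ s + t}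
      = ∫⁻ ω', μ {ω | blk x 0 (m+1) ω ≤ min s (s + t - blk x 1 k ω')} ∂μ := by
    intro m
    have hm : MeasurableSet {ω | blk x 0 (m+1) ω ≤ s ∧ blk x 0 (m+1+k) ω ≤ s + t} :=
      (measurableSet_le (mb _ _) measurable_const).inter (measurableSet_le (mb _ _) measurable_const)
    rw [← lintegral_indicator_one hm]
    have := lintegral_indep (μ := μ) (blk x 0 (m+1)) (blk x (m+1) k) (mb _ _) (mb _ _)
      (indep_blk x h.meas h.ind 0 (m+1) (m+1) k (by omega))
      (fun a b => if a ≤ min s (s + t - b) then 1 else 0) (by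
        refine Measurable.ite (measurableSet_le measurable_fst (by fun_prop)) measurable_const measurable_const)
    calc _ = ∫⁻ ω, (if blk x 0 (m+1) ω ≤ min s (s + t - blk x (m+1) k ω) then 1 else 0) ∂μ := by
          refine lintegral_congr fun ω => ?_
          simp only [Set.indicator_apply, Set.mem_ofPred_eq, Pi.one_apply, blk_add x 0 (m+1) k, zero_add, le_min_iff, le_sub_iff_add_le]
      _ = _ := this
      _ = ∫⁻ ω', μ {ω | blk x 0 (m+1) ω ≤ min s (s + t - blk x (m+1) k ω')} ∂μ := by
          refine lintegral_congr fun ω' => ?_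
          rw [← lintegral_indicator_one (measurableSet_le (mb _ _) measurable_const)]
          refine lintegral_congr fun ω => ?_
          simp only [Set.indicator_apply, Set.mem_ofPred_eq, Pi.one_apply]
      _ = _ := h.lint_blk m k _ (meas1 m)
  have e2 : ∑' m : ℕ, μ {ω | blk x 0 (m+1) ω ≤ s ∧ blk x 0 (m+1+k) ω ≤ s + t}
      = ∫⁻ ω', ENNReal.ofReal (min s (s + t - blk x 1 k ω')) ∂μ := by
    simp only [e1]
    rw [← lintegral_tsum (f := fun m ω' => μ {ω | blk x 0 (m+1) ω ≤ min s (s + t - blk x 1 k ω')})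
      (fun m => ((meas1 m).comp (mb 1 k)).aemeasurable)]
    exact lintegral_congr fun ω' => h.sumF h2 hb1 _
  rw [e2, ← lintegral_add_right _ (by fun_prop)]
  refine lintegral_congr fun ω => ?_
  set v := blk x 1 k ω
  rcases le_total v t with hv | hv
  · rw [min_eq_left (by linarith), ← ENNReal.ofReal_add hs (by linarith)]; congr 1; ring
  · rw [min_eq_right (by linarith), ENNReal.ofReal_of_nonpos (show t - v ≤ 0 by linarith), add_zero]

lemma EqRen.tail {Ω : Type*} [MeasurableSpace Ω] {μ : Measure Ω} [IsProbabilityMeasure μ] {S : Ω → ℝ} {x : ℕ → Ω → ℝ}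
    (h : EqRen μ S x) (h2 : Integrable (fun ω => S ω ^ 2) μ) (hb1 : 1 ≤ ∫ ω, S ω ^ 2 ∂μ) (k : ℕ) (s t : ℝ) (hs : 0 ≤ s) (ht : 0 ≤ t) :
    μ {ω | (k:ℝ) + 1 ≤ Nr x (s+t) ω - Nr x s ω} = μ {ω | blk x 0 (k+1) ω ≤ t} := by
  have mb := measurable_blk x h.meas
  have mN := measurable_Nr x h.meas
  have ms : ∀ m u, MeasurableSet {ω | blk x 0 m ω ≤ u} := fun m u => measurableSet_le (mb _ _) measurable_const
  set P : ℕ → Set Ω := fun m => {ω | blk x 0 m ω ≤ s ∧ s < blk x 0 (m+1) ω ∧ blk x 0 (m+k+1) ω ≤ s + t} with hP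
  have mP : ∀ m, MeasurableSet (P m) := fun m =>
    (ms _ _).inter ((measurableSet_lt measurable_const (mb _ _)).inter (ms _ _))
  have e1 : μ {ω | (k:ℝ) + 1 ≤ Nr x (s+t) ω - Nr x s ω} = ∑' m, μ (P m) := by
    have hm : MeasurableSet {ω | (k:ℝ) + 1 ≤ Nr x (s+t) ω - Nr x s ω} :=
      measurableSet_le measurable_const ((mN _).sub (mN _))
    rw [← lintegral_indicator_one hm]
    simp only [← lintegral_indicator_one (mP _)]
    rw [← lintegral_tsum (fun m => (measurable_one.indicator (mP m)).aemeasurable)]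
    refine lintegral_congr_ae ?_
    filter_upwards [h.spec h2 hb1] with ω hω
    obtain ⟨n, hn, -, hns⟩ := hω s hs
    obtain ⟨n', hn', -, hns'⟩ := hω (s+t) (by linarith)
    rw [tsum_eq_single n]
    · have : ω ∈ {ω | (k:ℝ) + 1 ≤ Nr x (s+t) ω - Nr x s ω} ↔ ω ∈ P n := by
        simp only [hP, Set.mem_ofPred_eq, hns, hns', hn, hn', lt_iff_not_ge]
        constructor
        · intro hh
          have : k + 1 + n ≤ n' := by
            have : (k:ℝ) + 1 + n ≤ n' := by linarith
            exact_mod_cast this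
          omega
        · rintro ⟨-, -, hh⟩
          have : ((n + k + 1 : ℕ):ℝ) ≤ n' := by exact_mod_cast hh
          push_cast at this; linarith
      by_cases hc : ω ∈ P n
      · rw [Set.indicator_of_mem hc, Set.indicator_of_mem (this.2 hc)]
      · rw [Set.indicator_of_notMem hc, Set.indicator_of_notMem (fun hh => hc (this.1 hh))]
    · intro m hmn
      rw [Set.indicator_of_notMem]
      simp only [hP, Set.mem_ofPred_eq, hns, lt_iff_not_ge]
      omega
  have e2 : ∑' m, μ (P m) + ∑' m, μ {ω | blk x 0 (m+1) ω ≤ s ∧ blk x 0 (m+1+k) ω ≤ s + t}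
      = ∑' m, μ {ω | blk x 0 m ω ≤ s ∧ blk x 0 (m+(k+1)) ω ≤ s + t} := by
    rw [← ENNReal.tsum_add]
    congr 1; ext m
    have mQ : MeasurableSet {ω | blk x 0 (m+1) ω ≤ s ∧ blk x 0 (m+1+k) ω ≤ s + t} := (ms _ _).inter (ms _ _)
    rw [← measure_union _ mQ]
    · congr 1; ext ω
      simp only [hP, Set.mem_union, Set.mem_ofPred_eq]
      have a1 : blk x 0 m ω ≤ blk x 0 (m+1) ω := by
        rw [blk_add]; linarith [blk_nn x h.nn (0+m) 1 ω]
      rw [show m + 1 + k = m + k + 1 by ring, show m + (k+1) = m + k + 1 by ring]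
      constructor
      · rintro (⟨q1, q2, q3⟩ | ⟨q1, q2⟩)
        · exact ⟨q1, q3⟩
        · exact ⟨a1.trans q1, q2⟩
      · rintro ⟨q1, q2⟩
        rcases lt_or_ge s (blk x 0 (m+1) ω) with hh | hh
        · exact Or.inl ⟨q1, hh, q2⟩
        · exact Or.inr ⟨hh, q2⟩
    · rw [Set.disjoint_left]
      rintro ω ⟨_, q2, _⟩ ⟨q1, _⟩
      exact absurd q1 (not_le.2 q2)
  have e3 : ∑' m, μ {ω | blk x 0 m ω ≤ s ∧ blk x 0 (m+(k+1)) ω ≤ s + t}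
      = μ {ω | blk x 0 (k+1) ω ≤ s + t} + ∑' m, μ {ω | blk x 0 (m+1) ω ≤ s ∧ blk x 0 (m+1+(k+1)) ω ≤ s + t} := by
    rw [tsum_eq_zero_add' ENNReal.summable]
    congr 2
    ext ω; simp [blk_zero, hs]
  have g1 := h.G h2 hb1 k s t hs
  have g2 := h.G h2 hb1 (k+1) s t hs
  have f1 := h.FH k (s+t)
  have f2 := h.FH k t
  rw [e1]
  have hfin : ∀ k u, ∫⁻ ω, ENNReal.ofReal (u - blk x 1 k ω) ∂μ ≠ ∞ := by
    intro k u
    refine ne_top_of_le_ne_top (b := ENNReal.ofReal u) ENNReal.ofReal_ne_top ?_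
    calc _ ≤ ∫⁻ ω, ENNReal.ofReal u ∂μ := lintegral_mono fun ω => ENNReal.ofReal_le_ofReal (by linarith [blk_nn x h.nn 1 k ω])
      _ = _ := by simp
  have n1 := hfin k t
  have n2 := hfin (k+1) t
  have n3 := hfin k (s+t)
  rw [e3] at e2
  set p := ∑' m, μ (P m)
  set Gk := ∑' m : ℕ, μ {ω | blk x 0 (m+1) ω ≤ s ∧ blk x 0 (m+1+k) ω ≤ s + t}
  set Gk' := ∑' m : ℕ, μ {ω | blk x 0 (m+1) ω ≤ s ∧ blk x 0 (m+1+(k+1)) ω ≤ s + t}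
  set Hk := ∫⁻ ω, ENNReal.ofReal (t - blk x 1 k ω) ∂μ
  set Hk1 := ∫⁻ ω, ENNReal.ofReal (t - blk x 1 (k+1) ω) ∂μ
  set Hs := ∫⁻ ω, ENNReal.ofReal (s + t - blk x 1 k ω) ∂μ
  set Hs1 := ∫⁻ ω, ENNReal.ofReal (s + t - blk x 1 (k+1) ω) ∂μ
  set F1 := μ {ω | blk x 0 (k+1) ω ≤ s + t}
  set F2 := μ {ω | blk x 0 (k+1) ω ≤ t}
  have key : p + (Hs + Hk1) = F2 + (Hs + Hk1) := by
    calc p + (Hs + Hk1) = (p + Gk) + Hk + Hk1 := by rw [← g1]; ring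
      _ = F1 + (Gk' + Hk1) + Hk := by rw [e2]; ring
      _ = Hs + Hk := by rw [g2, f1]
      _ = _ := by rw [← f2]; ring
  exact (ENNReal.add_left_inj (ENNReal.add_ne_top.2 ⟨n3, n2⟩)).1 key

lemma EqRen.law_inc {Ω : Type*} [MeasurableSpace Ω] {μ : Measure Ω} [IsProbabilityMeasure μ] {S : Ω → ℝ} {x : ℕ → Ω → ℝ}
    (h : EqRen μ S x) (h2 : Integrable (fun ω => S ω ^ 2) μ) (hb1 : 1 ≤ ∫ ω, S ω ^ 2 ∂μ) (s t : ℝ) (hs : 0 ≤ s) (ht : 0 ≤ t) :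
    μ.map (fun ω => Nr x (s+t) ω - Nr x s ω) = μ.map (Nr x t) := by
  have mN := measurable_Nr x h.meas
  have md : Measurable (fun ω => Nr x (s+t) ω - Nr x s ω) := (mN _).sub (mN _)
  have : IsProbabilityMeasure (μ.map (fun ω => Nr x (s+t) ω - Nr x s ω)) := Measure.isProbabilityMeasure_map md.aemeasurable
  apply Measure.ext_of_Ici
  intro a
  rw [Measure.map_apply md measurableSet_Ici, Measure.map_apply (mN t) measurableSet_Ici]
  have N0 : ∀ᵐ ω ∂μ, Nr x 0 ω = 0 := by
    have h0 := h.lint_cnt h2 hb1 0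
    rw [ENNReal.ofReal_zero, lintegral_eq_zero_iff (f := fun ω => cnt (fun j => x j ω) 0) ((measurable_cnt 0).comp (measurable_pi_lambda _ h.meas))] at h0
    filter_upwards [h0] with ω hω
    simp only [Pi.zero_apply] at hω
    simp [Nr, hω]
  have aux : ∀ s, 0 ≤ s → μ ((fun ω => Nr x (s+t) ω - Nr x s ω) ⁻¹' Set.Ici a) =
      if a ≤ 0 then 1 else μ {ω | blk x 0 (⌈a⌉₊ - 1 + 1) ω ≤ t} := by
    intro s hs
    split_ifs with ha
    · rw [← measure_univ (μ := μ)]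
      apply measure_congr
      filter_upwards [h.spec h2 hb1] with ω hω
      obtain ⟨n, hn, -, hns⟩ := hω s hs
      obtain ⟨n', hn', -, hns'⟩ := hω (s+t) (by linarith)
      have : n ≤ n' := (hns' n).1 (((hns n).2 le_rfl).trans (by linarith))
      have : (n:ℝ) ≤ n' := by exact_mod_cast this
      apply propext
      show a ≤ Nr x (s+t) ω - Nr x s ω ↔ True
      rw [hn, hn']
      exact iff_true_intro (by linarith)
    · rw [← h.tail h2 hb1 _ s t hs ht]
      apply measure_congr
      filter_upwards [h.spec h2 hb1] with ω hω
      obtain ⟨n, hn, -, hns⟩ := hω s hs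
      obtain ⟨n', hn', -, hns'⟩ := hω (s+t) (by linarith)
      apply propext
      show a ≤ Nr x (s+t) ω - Nr x s ω ↔ ((⌈a⌉₊ - 1 : ℕ):ℝ) + 1 ≤ Nr x (s+t) ω - Nr x s ω
      push Not at ha
      have h1 : 1 ≤ ⌈a⌉₊ := Nat.one_le_ceil_iff.2 ha
      have hle : n ≤ n' := (hns' n).1 (((hns n).2 le_rfl).trans (by linarith))
      have e : ((⌈a⌉₊ - 1 : ℕ):ℝ) + 1 = (⌈a⌉₊ : ℝ) := by
        rw [Nat.cast_sub h1]; push_cast; ring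
      rw [e, hn, hn', ← Nat.cast_sub hle]
      rw [Nat.cast_le, Nat.ceil_le]
  rw [aux s hs]
  have a0 := aux 0 le_rfl
  rw [← a0]
  apply measure_congr
  filter_upwards [N0] with ω hω
  apply propext
  show a ≤ Nr x (0+t) ω - Nr x 0 ω ↔ a ≤ Nr x t ω
  rw [hω]; simp

lemma base_moments {Ω : Type*} [MeasurableSpace Ω] {μ : Measure Ω} [IsProbabilityMeasure μ] (X : Ω → ℝ) (hX : Measurable X)
    (hn : ∀ ω, 0 ≤ X ω) (h1 : ∫ ω, X ω ∂μ = 1) (r : ℝ) (hr : 2 < r) (hi : Integrable (fun ω => X ω ^ r) μ) :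
    Integrable (fun ω => X ω ^ 2) μ ∧ 1 ≤ ∫ ω, X ω ^ 2 ∂μ ∧ ∫ ω, X ω ^ 2 ∂μ ≤ (∫ ω, X ω ^ r ∂μ) ^ (2/r) ∧
      1 ≤ ∫ ω, X ω ^ r ∂μ := by
  have ha : ∀ ω, |X ω| = X ω := fun ω => abs_of_nonneg (hn ω)
  have hi' : Integrable (fun ω => |X ω| ^ r) μ := by simpa only [ha] using hi
  have i2 : Integrable (fun ω => |X ω| ^ (2:ℝ)) μ := integrable_rpow_of_le hX (by norm_num) hr.le hi'
  have l1 := lyapunov hX (p := 1) (r := r) (by norm_num) (by linarith) (by linarith) hi'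
  have l2 := lyapunov hX (p := 2) (r := r) (by norm_num) (by linarith) (by linarith) hi'
  have l3 := lyapunov hX (p := 1) (r := 2) (by norm_num) (by linarith) (by linarith) i2
  simp only [ha, Real.rpow_one, h1, Real.rpow_two] at l1 l2 l3 i2
  refine ⟨i2, ?_, l2, ?_⟩
  · by_contra hc
    push Not at hc
    have := Real.rpow_lt_one (integral_nonneg fun ω => sq_nonneg _) hc (show (0:ℝ) < 1/2 by norm_num)
    linarith
  · by_contra hc
    push Not at hc
    have := Real.rpow_lt_one (integral_nonneg fun ω => Real.rpow_nonneg (hn ω) _) hc (show (0:ℝ) < 1/r by positivity)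
    linarith

/-- centred iid sums: increment bound -/
lemma iid_inc {Ω : Type*} [MeasurableSpace Ω] {μ : Measure Ω} [IsProbabilityMeasure μ] (X : Ω → ℝ) (hX : Measurable X)
    (hn : ∀ ω, 0 ≤ X ω) (hXi : Integrable X μ) (h1 : ∫ ω, X ω ∂μ = 1) (r : ℝ) (hr : 2 < r) (hi : Integrable (fun ω => X ω ^ r) μ)
    (y : ℕ → Ω → ℝ) (hy : ∀ j, Measurable (y j)) (hind : iIndepFun y μ) (hlaw : ∀ j, μ.map (y j) = μ.map X) (j k : ℕ) (hk : 1 ≤ k) :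
    ∫⁻ ω, ENNReal.ofReal (|(∑ i ∈ Finset.range (j+k), (y i ω - 1)) - ∑ i ∈ Finset.range j, (y i ω - 1)| ^ r) ∂μ
      ≤ ENNReal.ofReal ((15*r)^r * (∫ ω, X ω ^ r ∂μ) * (k:ℝ)^(r/2)) := by
  obtain ⟨i2, b1, b2, B1⟩ := base_moments X hX hn h1 r hr hi
  set B := ∫ ω, X ω ^ r ∂μ with hB
  set b := ∫ ω, X ω ^ 2 ∂μ with hb
  have hr0 : 0 < r := by linarith
  set W : ℕ → Ω → ℝ := fun i ω => y (j+i) ω - 1 with hW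
  have hid : ∀ i, IdentDistrib (W i) (fun ω => X ω - 1) μ μ := fun i =>
    (show IdentDistrib (y (j+i)) X μ μ from ⟨(hy _).aemeasurable, hX.aemeasurable, hlaw _⟩).comp
      (u := fun z : ℝ => z - 1) (by fun_prop)
  have hWind : iIndepFun W μ := by
    have a := hind.precomp (g := fun i => j + i) (fun a b hab => by simpa using hab)
    exact a.comp (fun _ z => z - 1) (fun _ => by fun_prop)
  have hpt : ∀ ω, |X ω - 1| ^ r ≤ X ω ^ r + 1 := by
    intro ω
    rcases le_total (X ω) 1 with hc | hc
    · have : |X ω - 1| ^ r ≤ 1 := by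
        apply Real.rpow_le_one (abs_nonneg _) _ hr0.le
        rw [abs_le]; constructor <;> linarith [hn ω]
      linarith [Real.rpow_nonneg (hn ω) r]
    · have : |X ω - 1| ^ r ≤ X ω ^ r := by
        apply Real.rpow_le_rpow (abs_nonneg _) _ hr0.le
        rw [abs_le]; constructor <;> linarith [hn ω]
      linarith
  have hi1 : Integrable (fun ω => |X ω - 1| ^ r) μ := by
    refine Integrable.mono' (hi.add (integrable_const 1)) (by
      have hq : Measurable (fun ω => |X ω - 1| ^ r) := by fun_prop
      exact hq.aestronglyMeasurable) (Filter.Eventually.of_forall fun ω => ?_)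
    rw [Real.norm_eq_abs, abs_of_nonneg (by positivity)]
    exact hpt ω
  have hidr : ∀ i, IdentDistrib (fun ω => |W i ω| ^ r) (fun ω => |X ω - 1| ^ r) μ μ := fun i =>
    (hid i).comp (u := fun z : ℝ => |z| ^ r) (by fun_prop)
  have hid2 : ∀ i, IdentDistrib (fun ω => (W i ω) ^ 2) (fun ω => (X ω - 1) ^ 2) μ μ := fun i =>
    (hid i).comp (u := fun z : ℝ => z ^ 2) (by fun_prop)
  have hs2 : ∫ ω, (X ω - 1)^2 ∂μ ≤ b := by
    have e : ∀ ω, (X ω - 1)^2 = X ω ^ 2 - (2 * X ω - 1) := fun ω => by ring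
    simp only [e]
    have i3 : Integrable (fun ω => 2 * X ω - 1) μ := (hXi.const_mul 2).sub (integrable_const 1)
    rw [integral_sub i2 i3, integral_sub (hXi.const_mul 2) (integrable_const 1), integral_const_mul, h1]
    simp [hb]
  have hmr : ∫ ω, |X ω - 1|^r ∂μ ≤ 2 * B := by
    calc ∫ ω, |X ω - 1|^r ∂μ ≤ ∫ ω, (X ω ^ r + 1) ∂μ := integral_mono hi1 (hi.add (integrable_const 1)) hpt
      _ = B + 1 := by rw [integral_add hi (integrable_const 1)]; simp [hB]
      _ ≤ _ := by linarith
  obtain ⟨R1, R2⟩ := rosenthal W (fun i => by simp only [hW]; exact (hy _).sub measurable_const) hWind r hr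
    (fun i => (hidr i).integrable_iff.2 hi1)
    (fun i => by
      rw [(hid i).integral_eq, integral_sub hXi (integrable_const 1), h1]; simp)
    b (2*B) (fun i => by rw [(hid2 i).integral_eq]; exact hs2) (fun i => by rw [(hidr i).integral_eq]; exact hmr) k hk
  have e : ∀ ω, (∑ i ∈ Finset.range (j+k), (y i ω - 1)) - ∑ i ∈ Finset.range j, (y i ω - 1) = ∑ i ∈ Finset.range k, W i ω := by
    intro ω; rw [Finset.sum_range_add]; simp [hW]
  simp only [e]
  rw [← ofReal_integral_eq_lintegral_ofReal R1 (Filter.Eventually.of_forall fun ω => by positivity)]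
  apply ENNReal.ofReal_le_ofReal
  refine R2.trans ?_
  have hk1 : (1:ℝ) ≤ k := by exact_mod_cast hk
  have c1 : (6*r^2*k*b)^(r/2) ≤ (3*r)^r * B * (k:ℝ)^(r/2) := by
    calc (6*r^2*k*b)^(r/2) ≤ ((3*r)^2 * k * B^(2/r))^(r/2) := by
          apply Real.rpow_le_rpow (by positivity) _ (by positivity)
          gcongr
          nlinarith [sq_nonneg r]
      _ = _ := by
          rw [Real.mul_rpow (by positivity) (by positivity), Real.mul_rpow (by positivity) (by positivity),
            ← Real.rpow_mul (by positivity), ← Real.rpow_natCast, ← Real.rpow_mul (by positivity)]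
          rw [show ((2:ℕ):ℝ) * (r/2) = r by push_cast; ring, show 2/r*(r/2) = 1 by field_simp, Real.rpow_one]
          ring
  have c2 : 2*(1+r)^r*k*(2*B) ≤ 4 * (3*r)^r * B * (k:ℝ)^(r/2) := by
    have a1 : (1+r)^r ≤ (3*r)^r := by apply Real.rpow_le_rpow <;> linarith
    have a2 : (k:ℝ) ≤ (k:ℝ)^(r/2) := by
      calc (k:ℝ) = (k:ℝ)^(1:ℝ) := by simp
        _ ≤ _ := Real.rpow_le_rpow_of_exponent_le hk1 (by linarith)
    calc 2*(1+r)^r*k*(2*B) = 4 * (1+r)^r * B * k := by ring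
      _ ≤ _ := by gcongr
  have c3 : 5 * (3*r)^r ≤ (15*r)^r := by
    rw [show 15*r = 5 * (3*r) by ring, Real.mul_rpow (x := 5) (y := 3*r) (by norm_num) (by positivity)]
    apply mul_le_mul_of_nonneg_right _ (by positivity)
    calc (5:ℝ) = 5^(1:ℝ) := by simp
      _ ≤ _ := Real.rpow_le_rpow_of_exponent_le (by norm_num) (by linarith)
  have c4 : 5 * (3*r)^r * (B * (k:ℝ)^(r/2)) ≤ (15*r)^r * (B * (k:ℝ)^(r/2)) := by gcongr
  linarith

lemma EqRen.x0_tail {Ω : Type*} [MeasurableSpace Ω] {μ : Measure Ω} [IsProbabilityMeasure μ] {S : Ω → ℝ} {x : ℕ → Ω → ℝ}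
    (h : EqRen μ S x) (y : ℝ) (hy : 0 ≤ y) : μ {ω | y < x 0 ω} = ∫⁻ ω, ENNReal.ofReal (S ω - y) ∂μ := by
  have hx := h.x0 y
  have hm : MeasurableSet {ω | x 0 ω ≤ y} := measurableSet_le (h.meas 0) measurable_const
  have h1 : μ {ω | y < x 0 ω} + μ {ω | x 0 ω ≤ y} = 1 := by
    have := measure_add_measure_compl (μ := μ) hm
    rw [measure_univ] at this
    rw [← this, add_comm]; congr 2; ext ω; simp
  have hSm := h.Smeas
  have h2 : ∫⁻ ω, ENNReal.ofReal (S ω - y) ∂μ + ENNReal.ofReal y = 1 + ∫⁻ ω, ENNReal.ofReal (y - S ω) ∂μ := by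
    have e1 : ∫⁻ ω, ENNReal.ofReal (S ω) ∂μ = 1 := by
      rw [← ofReal_integral_eq_lintegral_ofReal h.Sint (Filter.Eventually.of_forall h.Snn), h.ES]; simp
    have e2 : ∫⁻ _, ENNReal.ofReal y ∂μ = ENNReal.ofReal y := by simp
    rw [← e1]
    nth_rewrite 1 [← e2]
    rw [← lintegral_add_left (by fun_prop), ← lintegral_add_left (by fun_prop)]
    refine lintegral_congr fun ω => ?_
    have := h.Snn ω
    rcases le_total (S ω) y with hc | hc
    · rw [ENNReal.ofReal_of_nonpos (show S ω - y ≤ 0 by linarith), zero_add, ← ENNReal.ofReal_add this (by linarith)]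
      congr 1; ring
    · rw [ENNReal.ofReal_of_nonpos (show y - S ω ≤ 0 by linarith), add_zero, ← ENNReal.ofReal_add (by linarith) hy]
      congr 1; ring
  have hf1 : ∫⁻ ω, ENNReal.ofReal (y - S ω) ∂μ ≠ ∞ := by
    intro hc; rw [hc] at hx; simp at hx
  have hf2 : μ {ω | x 0 ω ≤ y} ≠ ∞ := measure_ne_top _ _
  refine (ENNReal.add_left_inj (ENNReal.add_ne_top.2 ⟨hf2, hf1⟩)).1 ?_
  rw [← add_assoc, h1, ← h2, hx]

lemma EqRen.min_moment {Ω : Type*} [MeasurableSpace Ω] {μ : Measure Ω} [IsProbabilityMeasure μ] {S : Ω → ℝ} {x : ℕ → Ω → ℝ}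
    (h : EqRen μ S x) (r : ℝ) (hr : 2 < r) (hi : Integrable (fun ω => S ω ^ r) μ) (t : ℝ) (ht : 0 ≤ t) :
    ∫⁻ ω, ENNReal.ofReal ((min (x 0 ω) t) ^ r) ∂μ ≤ ENNReal.ofReal (r * t * ∫ ω, S ω ^ r ∂μ) := by
  have hr0 : 0 < r := by linarith
  set B := ∫ ω, S ω ^ r ∂μ with hB
  have hB0 : 0 ≤ B := integral_nonneg fun ω => Real.rpow_nonneg (h.Snn ω) _
  have hx0 := h.meas 0
  rw [lintegral_rpow_eq_lintegral_meas_lt_mul μ (f := fun ω => min (x 0 ω) t)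
    (Filter.Eventually.of_forall fun ω => le_min (h.nn 0 ω) ht) (by fun_prop) hr0]
  have key : ∀ y ∈ Set.Ioi (0:ℝ), μ {a | y < min (x 0 a) t} * ENNReal.ofReal (y ^ (r-1)) ≤
      (Set.Ioc 0 t).indicator (fun _ => ENNReal.ofReal B) y := by
    intro y hy
    have hy0 : (0:ℝ) < y := hy
    simp only [Set.indicator_apply, Set.mem_Ioc]
    split_ifs with hc
    · have h1 : μ {a | y < min (x 0 a) t} ≤ ENNReal.ofReal (B * y^(1-r)) := by
        refine (measure_mono (t := {a | y < x 0 a}) fun a (ha : y < min (x 0 a) t) => (lt_min_iff.1 ha).1).trans ?_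
        rw [h.x0_tail y hy0.le, hB, ← integral_mul_const,
          ofReal_integral_eq_lintegral_ofReal (hi.mul_const _) (Filter.Eventually.of_forall fun ω => by
            have := h.Snn ω; positivity)]
        refine lintegral_mono fun ω => ENNReal.ofReal_le_ofReal ?_
        have hs := h.Snn ω
        rcases le_total (S ω) y with hc | hc
        · have : 0 ≤ S ω ^ r * y^(1-r) := by positivity
          linarith
        · have hsp : 0 < S ω := by linarith
          have e : S ω = S ω ^ r * S ω ^ (1-r) := by
            rw [← Real.rpow_add hsp]; simp
          calc S ω - y ≤ S ω := by linarith
            _ = S ω ^ r * S ω ^ (1-r) := e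
            _ ≤ _ := by
              apply mul_le_mul_of_nonneg_left _ (by positivity)
              exact Real.rpow_le_rpow_of_nonpos hy0 hc (by linarith)
      calc _ ≤ ENNReal.ofReal (B * y^(1-r)) * ENNReal.ofReal (y ^ (r-1)) := by gcongr
        _ = ENNReal.ofReal B := by
          rw [← ENNReal.ofReal_mul (by positivity), mul_assoc, ← Real.rpow_add hy0]; simp
    · have : {a | y < min (x 0 a) t} = ∅ := by
        ext a
        simp only [Set.mem_ofPred_eq, lt_min_iff, Set.mem_empty_iff_false, iff_false]
        rintro ⟨-, h2⟩
        exact hc ⟨hy0, h2.le⟩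
      rw [this]; simp
  calc _ ≤ ENNReal.ofReal r * ∫⁻ y in Set.Ioi 0, (Set.Ioc 0 t).indicator (fun _ => ENNReal.ofReal B) y := by
        gcongr ENNReal.ofReal r * ?_
        exact setLIntegral_mono' measurableSet_Ioi key
    _ ≤ ENNReal.ofReal r * ∫⁻ y, (Set.Ioc 0 t).indicator (fun _ => ENNReal.ofReal B) y := by
        gcongr ENNReal.ofReal r * ?_
        exact setLIntegral_le_lintegral _ _
    _ = _ := by
        rw [lintegral_indicator_const measurableSet_Ioc, Real.volume_Ioc, sub_zero, ← ENNReal.ofReal_mul hB0, ← ENNReal.ofReal_mul hr0.le]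
        congr 1; ring

lemma three_rpow (a b c : ℝ≥0∞) (r : ℝ) (hr : 0 < r) : (a+b+c)^r ≤ 3^r * (a^r+b^r+c^r) := by
  set M := max a (max b c) with hM
  have h1 : a + b + c ≤ 3 * M := by
    have e : 3 * M = M + M + M := by ring
    rw [e]
    exact add_le_add (add_le_add (le_max_left _ _) ((le_max_left _ _).trans (le_max_right _ _)))
      ((le_max_right _ _).trans (le_max_right _ _))
  have h2 : M ^ r ≤ a^r+b^r+c^r := by
    rcases max_choice a (max b c) with h | h
    · rw [hM, h, add_assoc]; exact le_self_add
    · rcases max_choice b c with h' | h'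
      · rw [hM, h, h', add_right_comm, add_comm]; exact le_self_add
      · rw [hM, h, h']; exact le_add_self
  calc (a+b+c)^r ≤ (3*M)^r := ENNReal.rpow_le_rpow h1 hr.le
    _ = 3^r * M^r := ENNReal.mul_rpow_of_nonneg _ _ hr.le
    _ ≤ _ := by gcongr

lemma EqRen.mom_large_raw {Ω : Type*} [MeasurableSpace Ω] {μ : Measure Ω} [IsProbabilityMeasure μ] {S : Ω → ℝ} {x : ℕ → Ω → ℝ}
    (h : EqRen μ S x) (r : ℝ) (hr : 2 < r) (hi : Integrable (fun ω => S ω ^ r) μ) (t : ℝ) (ht : 1 ≤ t) :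
    ∫⁻ ω, ENNReal.ofReal (|Nr x t ω - t| ^ r) ∂μ ≤
      ENNReal.ofReal (3^r * (1 + r * t * (∫ ω, S ω ^ r ∂μ) + (5*r/(r-2))^r * ((15*r)^r * (∫ ω, S ω ^ r ∂μ)) * (8*t)^(r/2))
        + 40*(16*r)^r * (∫ ω, S ω ^ 2 ∂μ)^(r+1)) := by
  obtain ⟨h2, hb1, hbB, hB1⟩ := base_moments S h.Smeas h.Snn h.ES r hr hi
  set B := ∫ ω, S ω ^ r ∂μ with hB
  obtain ⟨b, hb⟩ : ∃ b, b = ∫ ω, S ω ^ 2 ∂μ := ⟨_, rfl⟩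
  have hr0 : 0 < r := by linarith
  have hK : 0 < 5*r/(r-2) := div_pos (by linarith) (by linarith)
  have mb := measurable_blk x h.meas
  -- choose the dyadic level
  obtain ⟨m, hm1, hm2⟩ : ∃ m : ℕ, 4*t ≤ (2:ℝ)^m ∧ (2:ℝ)^m ≤ 8*t := by
    obtain ⟨n, hn1, hn2⟩ := exists_nat_pow_near (show (1:ℝ) ≤ 4*t by linarith) (show (1:ℝ) < 2 by norm_num)
    refine ⟨n+1, hn2.le, ?_⟩
    rw [pow_succ]; linarith
  set X : ℕ → Ω → ℝ := fun k ω => ∑ i ∈ Finset.range k, (x (1+i) ω - 1) with hX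
  have hXm : ∀ k, Measurable (X k) := fun k => by
    have := h.meas
    simp only [hX]; fun_prop
  have hXb : ∀ k ω, X k ω = blk x 1 k ω - k := by
    intro k ω; simp [hX, blk]
  have hG : ∫⁻ ω, gMax X m ω ^ r ∂μ ≤ ENNReal.ofReal ((5*r/(r-2))^r * ((15*r)^r * B) * (2^m:ℝ)^(r/2)) := by
    refine chain r hr X ((15*r)^r * B) (by positivity) hXm (by simp [hX]) ?_ m
    intro j k hk
    exact iid_inc S h.Smeas h.Snn h.Sint h.ES r hr hi (fun i => x (1+i)) (fun i => h.meas _)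
      (h.ind.precomp (g := fun i => 1+i) (fun a b hab => by simpa using hab)) (fun i => by rw [add_comm]; exact h.law i) j k hk
  set T : ℕ → Set Ω := fun k => {ω | 4*t ≤ k ∧ blk x 1 k ω ≤ t} with hT
  have hTm : ∀ k, MeasurableSet (T k) := fun k =>
    (MeasurableSet.const _).inter (measurableSet_le (mb _ _) measurable_const)
  have path : ∀ᵐ ω ∂μ, ENNReal.ofReal (|Nr x t ω - t| ^ r) ≤
      3^r * (1 + ENNReal.ofReal ((min (x 0 ω) t)^r) + gMax X m ω ^ r) +
        ∑' k : ℕ, (T k).indicator (fun _ => ENNReal.ofReal (((k:ℝ)+1)^r)) ω := by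
    filter_upwards [h.spec h2 hb1] with ω hω
    obtain ⟨n, hn, -, hs⟩ := hω t (by linarith)
    rw [hn]
    have hx0 := h.nn 0 ω
    have b1 : ∀ k, blk x 0 (k+1) ω = x 0 ω + blk x 1 k ω := by
      intro k; rw [add_comm k 1, blk_add, blk_one]
    have main : ∀ g : ℝ, 0 ≤ g → ENNReal.ofReal g ≤ gMax X m ω → |(n:ℝ) - t| ≤ 1 + min (x 0 ω) t + g →
        ENNReal.ofReal (|(n:ℝ) - t| ^ r) ≤ 3^r * (1 + ENNReal.ofReal ((min (x 0 ω) t)^r) + gMax X m ω ^ r) := by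
      intro g hg0 hg hle
      have hmin : 0 ≤ min (x 0 ω) t := le_min hx0 (by linarith)
      rw [← ofReal_rpow' _ _ (abs_nonneg _) hr0.le, ← ofReal_rpow' _ _ hmin hr0.le]
      calc _ ≤ (1 + ENNReal.ofReal (min (x 0 ω) t) + gMax X m ω)^r := by
            apply ENNReal.rpow_le_rpow _ hr0.le
            calc _ ≤ ENNReal.ofReal (1 + min (x 0 ω) t + g) := ENNReal.ofReal_le_ofReal hle
              _ = 1 + ENNReal.ofReal (min (x 0 ω) t) + ENNReal.ofReal g := by
                rw [ENNReal.ofReal_add (by positivity) hg0, ENNReal.ofReal_add (by norm_num) hmin]; simp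
              _ ≤ _ := by gcongr
        _ ≤ _ := by
          have := three_rpow 1 (ENNReal.ofReal (min (x 0 ω) t)) (gMax X m ω) r hr0
          simpa using this
    rcases n with _ | k
    · refine (main 0 le_rfl (by simp) ?_).trans le_self_add
      have : t < x 0 ω := by
        have := hs 1
        rw [blk_one] at this
        by_contra hc; push Not at hc
        have := this.1 hc; omega
      rw [min_eq_right this.le]
      simp only [Nat.cast_zero, zero_sub, abs_neg]
      rw [abs_of_nonneg (by linarith)]; linarith
    · have e1 := (hs (k+1)).2 le_rfl
      have e2 : t < blk x 0 (k+1+1) ω := by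
        by_contra hc; push Not at hc
        have := (hs (k+1+1)).1 hc; omega
      rw [b1] at e1 e2
      have hV := blk_nn x h.nn 1 k ω
      by_cases hk : k+1 ≤ 2^m
      · refine (main (max |X k ω| |X (k+1) ω|) (by positivity) ?_ ?_).trans le_self_add
        · rcases max_choice |X k ω| |X (k+1) ω| with hh | hh <;> rw [hh]
          · exact le_gMax X m k (by omega) ω
          · exact le_gMax X m _ hk ω
        · rw [min_eq_left (by linarith)]
          have q1 := le_max_left |X k ω| |X (k+1) ω|
          have q2 := le_max_right |X k ω| |X (k+1) ω|
          have q3 := neg_abs_le (X k ω)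
          have q4 := le_abs_self (X (k+1) ω)
          have q5 := hXb k ω
          have q6 := hXb (k+1) ω
          push_cast at q6 ⊢
          rw [abs_le]; constructor <;> linarith
      · push Not at hk
        have hk' : (2:ℝ)^m ≤ k := by exact_mod_cast (by omega : 2^m ≤ k)
        have hmem : ω ∈ T k := ⟨by linarith, by linarith⟩
        refine le_trans ?_ le_add_self
        refine le_trans ?_ (ENNReal.le_tsum k)
        rw [Set.indicator_of_mem hmem]
        apply ENNReal.ofReal_le_ofReal
        apply Real.rpow_le_rpow (abs_nonneg _) _ hr0.le
        push_cast
        rw [abs_le]; constructor <;> linarith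
  have sumb : ∫⁻ ω, ∑' k : ℕ, (T k).indicator (fun _ => ENNReal.ofReal (((k:ℝ)+1)^r)) ω ∂μ ≤ ENNReal.ofReal (40*(16*r)^r * b^(r+1)) := by
    rw [lintegral_tsum (fun k => (measurable_const.indicator (hTm k)).aemeasurable)]
    refine le_trans (ENNReal.tsum_le_tsum fun k => ?_) (sum_poly_exp r b (by linarith) (by rw [hb]; exact hb1))
    rw [lintegral_indicator_const (hTm k), ENNReal.ofReal_mul (by positivity)]
    gcongr
    by_cases hc : 4*t ≤ k
    · refine (measure_mono (t := {ω | blk x 1 k ω ≤ t}) fun ω hω => hω.2).trans ?_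
      refine (h.V_exp h2 b hb (by rw [hb]; exact hb1) k t).trans (ENNReal.ofReal_le_ofReal (Real.exp_le_exp.2 ?_))
      have hb0 : 0 < b := by rw [hb]; linarith
      rw [div_le_div_iff₀ (by positivity) (by positivity)]
      nlinarith
    · have : T k = ∅ := by
        ext ω; simp [hT, hc]
      rw [this]; simp
  have mg := measurable_gMax X hXm m
  have mx0 := h.meas 0
  calc _ ≤ ∫⁻ ω, (3^r * (1 + ENNReal.ofReal ((min (x 0 ω) t)^r) + gMax X m ω ^ r) +
        ∑' k : ℕ, (T k).indicator (fun _ => ENNReal.ofReal (((k:ℝ)+1)^r)) ω) ∂μ := lintegral_mono_ae path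
    _ = 3^r * (1 + ∫⁻ ω, ENNReal.ofReal ((min (x 0 ω) t)^r) ∂μ + ∫⁻ ω, gMax X m ω ^ r ∂μ) +
        ∫⁻ ω, ∑' k : ℕ, (T k).indicator (fun _ => ENNReal.ofReal (((k:ℝ)+1)^r)) ω ∂μ := by
      rw [lintegral_add_left (by fun_prop), lintegral_const_mul _ (by fun_prop), lintegral_add_left (by fun_prop),
        lintegral_add_left (by fun_prop)]
      simp
    _ ≤ ENNReal.ofReal (3^r) * (ENNReal.ofReal 1 + ENNReal.ofReal (r * t * B) + ENNReal.ofReal ((5*r/(r-2))^r * ((15*r)^r * B) * (8*t)^(r/2))) +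
        ENNReal.ofReal (40*(16*r)^r * b^(r+1)) := by
      have e3 : (3:ℝ≥0∞)^r = ENNReal.ofReal (3^r) := by
        rw [← ofReal_rpow' 3 r (by norm_num) hr0.le]; simp
      rw [e3]
      gcongr
      · simp
      · exact h.min_moment r hr hi t (by linarith)
      · refine hG.trans (ENNReal.ofReal_le_ofReal ?_)
        apply mul_le_mul_of_nonneg_left _ (by positivity)
        exact Real.rpow_le_rpow (by positivity) hm2 (by positivity)
    _ = _ := by
      have hb0 : 0 < b := by rw [hb]; linarith
      rw [← hb]
      have t0 : 0 ≤ t := by linarith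
      rw [← ENNReal.ofReal_add (by norm_num) (by positivity), ← ENNReal.ofReal_add (by positivity) (by positivity),
        ← ENNReal.ofReal_mul (by positivity), ← ENNReal.ofReal_add (by positivity) (by positivity)]

lemma EqRen.mom_small {Ω : Type*} [MeasurableSpace Ω] {μ : Measure Ω} [IsProbabilityMeasure μ] {S : Ω → ℝ} {x : ℕ → Ω → ℝ}
    (h : EqRen μ S x) (h2 : Integrable (fun ω => S ω ^ 2) μ) (hb1 : 1 ≤ ∫ ω, S ω ^ 2 ∂μ)
    (p : ℝ) (hp : 2 ≤ p) (t : ℝ) (ht : 0 < t) (ht1 : t ≤ 1) :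
    ∫⁻ ω, ENNReal.ofReal (|Nr x t ω - t| ^ p) ∂μ ≤
      ENNReal.ofReal (t * (1 + 4^p + 40*(16*p)^p * (∫ ω, S ω ^ 2 ∂μ)^(p+1))) := by
  obtain ⟨b, hb⟩ : ∃ b, b = ∫ ω, S ω ^ 2 ∂μ := ⟨_, rfl⟩
  have hb1' : 1 ≤ b := by rw [hb]; exact hb1
  have hp0 : 0 < p := by linarith
  have mb := measurable_blk x h.meas
  set U : Set Ω := {ω | x 0 ω ≤ t} with hU
  have hUm : MeasurableSet U := measurableSet_le (h.meas 0) measurable_const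
  have hUt : μ U ≤ ENNReal.ofReal t := by rw [← h.x0 t]; exact le_self_add
  set T : ℕ → Set Ω := fun k => {ω | (4:ℝ) ≤ k ∧ x 0 ω ≤ t ∧ blk x 1 k ω ≤ 1} with hT
  have hTm : ∀ k, MeasurableSet (T k) := fun k =>
    (MeasurableSet.const _).inter ((measurableSet_le (h.meas 0) measurable_const).inter (measurableSet_le (mb _ _) measurable_const))
  have path : ∀ᵐ ω ∂μ, ENNReal.ofReal (|Nr x t ω - t| ^ p) ≤ ENNReal.ofReal t + U.indicator (fun _ => ENNReal.ofReal (4^p)) ω +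
        ∑' k : ℕ, (T k).indicator (fun _ => ENNReal.ofReal (((k:ℝ)+1)^p)) ω := by
    filter_upwards [h.spec h2 hb1] with ω hω
    obtain ⟨n, hn, -, hs⟩ := hω t ht.le
    rw [hn]
    have b1 : ∀ k, blk x 0 (k+1) ω = x 0 ω + blk x 1 k ω := by
      intro k; rw [add_comm k 1, blk_add, blk_one]
    rcases n with _ | k
    · rw [add_assoc]
      refine le_trans (ENNReal.ofReal_le_ofReal ?_) le_self_add
      simp only [Nat.cast_zero, zero_sub, abs_neg]
      rw [abs_of_nonneg ht.le]
      calc t^p ≤ t^(1:ℝ) := Real.rpow_le_rpow_of_exponent_ge ht ht1 (by linarith)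
        _ = t := by simp
    · have e1 := (hs (k+1)).2 le_rfl
      rw [b1] at e1
      have hV := blk_nn x h.nn 1 k ω
      have hx0 := h.nn 0 ω
      have hle : |((k+1:ℕ):ℝ) - t| ≤ k+1 := by
        have : (0:ℝ) ≤ k := by positivity
        push_cast; rw [abs_le]; constructor <;> linarith
      have hle2 : ENNReal.ofReal (|((k+1:ℕ):ℝ) - t|^p) ≤ ENNReal.ofReal (((k:ℝ)+1)^p) :=
        ENNReal.ofReal_le_ofReal (Real.rpow_le_rpow (abs_nonneg _) hle hp0.le)
      refine hle2.trans ?_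
      by_cases hk : k ≤ 3
      · refine le_trans ?_ le_self_add
        refine le_trans ?_ le_add_self
        rw [Set.indicator_of_mem (show ω ∈ U by show x 0 ω ≤ t; linarith)]
        apply ENNReal.ofReal_le_ofReal
        apply Real.rpow_le_rpow (by positivity) _ hp0.le
        have : (k:ℝ) ≤ 3 := by exact_mod_cast hk
        linarith
      · refine le_trans ?_ le_add_self
        refine le_trans ?_ (ENNReal.le_tsum k)
        rw [Set.indicator_of_mem]
        refine ⟨by exact_mod_cast (by omega : 4 ≤ k), by linarith, by linarith⟩
  have sumb : ∫⁻ ω, ∑' k : ℕ, (T k).indicator (fun _ => ENNReal.ofReal (((k:ℝ)+1)^p)) ω ∂μ ≤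
      ENNReal.ofReal t * ENNReal.ofReal (40*(16*p)^p * b^(p+1)) := by
    rw [lintegral_tsum (fun k => (measurable_const.indicator (hTm k)).aemeasurable)]
    refine le_trans ?_ (mul_le_mul_right (sum_poly_exp p b (by linarith) hb1') _)
    rw [← ENNReal.tsum_mul_left]
    refine ENNReal.tsum_le_tsum fun k => ?_
    rw [lintegral_indicator_const (hTm k), ENNReal.ofReal_mul (by positivity), mul_left_comm]
    gcongr
    by_cases hc : (4:ℝ) ≤ k
    · have e : T k ⊆ blk x 0 1 ⁻¹' Set.Iic t ∩ blk x 1 k ⁻¹' Set.Iic 1 := by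
        rintro ω ⟨-, h1, h2⟩
        exact ⟨by show blk x 0 1 ω ≤ t; rw [blk_one]; exact h1, h2⟩
      refine (measure_mono e).trans ?_
      rw [(indep_blk x h.meas h.ind 0 1 1 k (by norm_num)).measure_inter_preimage_eq_mul _ _ measurableSet_Iic measurableSet_Iic]
      have e2 : blk x 0 1 ⁻¹' Set.Iic t = U := by
        ext ω; show blk x 0 1 ω ≤ t ↔ x 0 ω ≤ t; rw [blk_one]
      rw [e2]
      refine mul_le_mul' hUt ?_
      refine (h.V_exp h2 b hb hb1' k 1).trans (ENNReal.ofReal_le_ofReal (Real.exp_le_exp.2 ?_))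
      rw [div_le_div_iff₀ (by positivity) (by positivity)]
      nlinarith
    · have : T k = ∅ := by
        ext ω
        simp only [hT, Set.mem_ofPred_eq, Set.mem_empty_iff_false, iff_false]
        rintro ⟨h1, -⟩; exact hc h1
      rw [this]; simp
  calc _ ≤ ∫⁻ ω, (ENNReal.ofReal t + U.indicator (fun _ => ENNReal.ofReal (4^p)) ω +
        ∑' k : ℕ, (T k).indicator (fun _ => ENNReal.ofReal (((k:ℝ)+1)^p)) ω) ∂μ := lintegral_mono_ae path
    _ = ENNReal.ofReal t + ENNReal.ofReal (4^p) * μ U +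
        ∫⁻ ω, ∑' k : ℕ, (T k).indicator (fun _ => ENNReal.ofReal (((k:ℝ)+1)^p)) ω ∂μ := by
      rw [lintegral_add_left (f := fun ω => ENNReal.ofReal t + U.indicator (fun _ => ENNReal.ofReal (4^p)) ω)
        (Measurable.const_add (measurable_const.indicator hUm) _), lintegral_add_left measurable_const,
        lintegral_indicator_const hUm]
      simp
    _ ≤ ENNReal.ofReal t + ENNReal.ofReal (4^p) * ENNReal.ofReal t + ENNReal.ofReal t * ENNReal.ofReal (40*(16*p)^p * b^(p+1)) := by
      gcongr
    _ = _ := by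
      rw [← hb, ← ENNReal.ofReal_mul (by positivity), ← ENNReal.ofReal_mul (by positivity),
        ← ENNReal.ofReal_add (by positivity) (by positivity), ← ENNReal.ofReal_add (by positivity) (by positivity)]
      congr 1; ring

lemma le_rpow_of_two_le (a c r : ℝ) (ha : 0 ≤ c) (hr : 2 ≤ r) (h1 : 1 ≤ c) (h : a ≤ c^2) : a ≤ c ^ r := by
  refine h.trans ?_
  rw [← Real.rpow_two]
  exact Real.rpow_le_rpow_of_exponent_le h1 hr

lemma num_aux (r b B q : ℝ) (hr : 2 < r) (hb : 1 ≤ b) (hbB : b ≤ B^(2/r)) (hB : 1 ≤ B) (hq : 5 * r ≤ q) :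
    b^(r+1) ≤ B^3 ∧ b^3 ≤ B^(6/r) ∧ 40*(16*r)^r ≤ (112*q)^r := by
  have hr0 : 0 < r := by linarith
  refine ⟨?_, ?_, ?_⟩
  · calc b^(r+1) ≤ (B^(2/r))^(r+1) := Real.rpow_le_rpow (by linarith) hbB (by linarith)
      _ = B^(2/r*(r+1)) := by rw [← Real.rpow_mul (by linarith)]
      _ ≤ B^(3:ℝ) := by
        apply Real.rpow_le_rpow_of_exponent_le hB
        rw [div_mul_eq_mul_div, div_le_iff₀ hr0]; linarith
      _ = B^3 := by norm_cast
  · calc b^3 ≤ (B^(2/r))^3 := by gcongr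
      _ = B^(6/r) := by
        rw [← Real.rpow_natCast, ← Real.rpow_mul (by linarith)]; congr 1; push_cast; ring
  · calc 40*(16*r)^r ≤ 7^r * (16*q)^r := by
          gcongr
          · exact le_rpow_of_two_le _ _ _ (by norm_num) hr.le (by norm_num) (by norm_num)
          · linarith
      _ = (112*q)^r := by
        rw [← Real.mul_rpow (by norm_num) (by linarith)]; congr 1; ring

lemma EqRen.mom_r {Ω : Type*} [MeasurableSpace Ω] {μ : Measure Ω} [IsProbabilityMeasure μ] {S : Ω → ℝ} {x : ℕ → Ω → ℝ}
    (h : EqRen μ S x) (r : ℝ) (hr : 2 < r) (hi : Integrable (fun ω => S ω ^ r) μ) (t : ℝ) (ht : 0 < t) :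
    ∫⁻ ω, ENNReal.ofReal (|Nr x t ω - t| ^ r) ∂μ ≤
      ENNReal.ofReal ((2000*r*(5*r/(r-2)))^r * (∫ ω, S ω ^ r ∂μ)^3 * max t (t^(r/2))) := by
  obtain ⟨h2, hb1, hbB, hB1⟩ := base_moments S h.Smeas h.Snn h.ES r hr hi
  set B := ∫ ω, S ω ^ r ∂μ with hB
  set b := ∫ ω, S ω ^ 2 ∂μ with hb
  have hr0 : 0 < r := by linarith
  have hr2 : 0 < r - 2 := by linarith
  have hK : 5 ≤ 5*r/(r-2) := by rw [le_div_iff₀ hr2]; linarith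
  set K := 5*r/(r-2) with hKd
  have hq : 5 * r ≤ r*K := by nlinarith
  have hq10 : 10 ≤ r*K := by linarith
  obtain ⟨n1, n2, n3⟩ := num_aux r b B (r*K) hr hb1 hbB hB1 hq
  set q := r*K with hqd
  have hBB3 : B ≤ B^3 := by nlinarith [mul_pos (by linarith : 0 < B) (by linarith : 0 < B), pow_succ B 2, sq_nonneg (B-1)]
  have hB3 : 1 ≤ B^3 := hB1.trans hBB3
  have p135 : 0 < (135*q)^r := by positivity
  have e405 : 3 * (135*q)^r ≤ (2000*r*K)^r := by
    calc 3 * (135*q)^r ≤ 2^r * (135*q)^r := by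
          apply mul_le_mul_of_nonneg_right _ p135.le
          exact le_rpow_of_two_le _ _ _ (by norm_num) hr.le (by norm_num) (by norm_num)
      _ = (270*q)^r := by
        rw [← Real.mul_rpow (by norm_num) (by linarith)]; congr 1; ring
      _ ≤ _ := by
        apply Real.rpow_le_rpow (by positivity) _ hr0.le
        rw [mul_assoc]; linarith
  have e112 : (112*q)^r ≤ (135*q)^r := Real.rpow_le_rpow (by positivity) (by linarith) hr0.le
  have hqr : q ≤ q^r := le_rpow_of_two_le _ _ _ (by linarith) hr.le (by linarith) (by nlinarith)
  have e3 : 3^r * (1+r) ≤ (3*q)^r := by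
    rw [Real.mul_rpow (by norm_num) (by linarith)]
    apply mul_le_mul_of_nonneg_left _ (by positivity)
    linarith
  have e3' : (3*q)^r ≤ (135*q)^r := Real.rpow_le_rpow (by positivity) (by linarith) hr0.le
  rcases le_total 1 t with h1 | h1
  · refine (h.mom_large_raw r hr hi t h1).trans (ENNReal.ofReal_le_ofReal ?_)
    rw [← hB, ← hb, ← hKd]
    set T := t^(r/2) with hT
    have hT1 : t ≤ T := by
      calc t = t^(1:ℝ) := by simp
        _ ≤ _ := Real.rpow_le_rpow_of_exponent_le h1 (by linarith)
    rw [max_eq_right hT1]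
    have hBT : 1 ≤ B^3*T := by nlinarith
    have a1 : 3^r * (1 + r*t*B) ≤ (135*q)^r * (B^3*T) := by
      calc 3^r * (1 + r*t*B) ≤ 3^r * ((1+r)*(B^3*T)) := by
            have : t*B ≤ B^3*T := by
              rw [mul_comm]; exact mul_le_mul hBB3 hT1 (by linarith) (by linarith)
            apply mul_le_mul_of_nonneg_left _ (by positivity)
            nlinarith
        _ = (3^r*(1+r)) * (B^3*T) := by ring
        _ ≤ _ := by
          apply mul_le_mul_of_nonneg_right (e3.trans e3') (by linarith)
    have a2 : 3^r*(K^r * ((15*r)^r * B) * (8*t)^(r/2)) ≤ (135*q)^r * (B^3*T) := by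
      have : (8*t)^(r/2) ≤ 3^r * T := by
        rw [Real.mul_rpow (by norm_num) (by linarith)]
        apply mul_le_mul_of_nonneg_right _ (by linarith)
        calc (8:ℝ)^(r/2) ≤ (3^2)^(r/2) := Real.rpow_le_rpow (by norm_num) (by norm_num) (by linarith)
          _ = 3^r := by
            rw [← Real.rpow_natCast, ← Real.rpow_mul (by norm_num)]; congr 1; push_cast; ring
      have e : (135*q)^r = 3^r * (K^r * ((15*r)^r * 3^r)) := by
        rw [← Real.mul_rpow (by positivity) (by positivity), ← Real.mul_rpow (by positivity) (by positivity),
          ← Real.mul_rpow (by positivity) (by positivity)]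
        congr 1; rw [hqd]; ring
      rw [e]
      calc _ ≤ 3^r*(K^r * ((15*r)^r * B^3) * (3^r * T)) := by
            gcongr
        _ = _ := by ring
    have a3 : 40*(16*r)^r * b^(r+1) ≤ (135*q)^r * (B^3*T) := by
      calc 40*(16*r)^r * b^(r+1) ≤ (112*q)^r * B^3 := by gcongr
        _ ≤ (135*q)^r * B^3 := by gcongr
        _ ≤ _ := by
          have hh : 0 ≤ (135*q)^r*B^3 := by positivity
          have := mul_le_mul_of_nonneg_left (h1.trans hT1) hh
          linarith
    have a4 : 3 * (135*q)^r * (B^3*T) ≤ (2000*r*K)^r * (B^3*T) := mul_le_mul_of_nonneg_right e405 (by linarith)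
    rw [mul_add]
    linarith
  · refine (h.mom_small h2 hb1 r hr.le t ht h1).trans (ENNReal.ofReal_le_ofReal ?_)
    rw [← hb]
    have a1 : 1 + 4^r ≤ 2*(135*q)^r * B^3 := by
      have c1 : (4:ℝ)^r ≤ (135*q)^r := Real.rpow_le_rpow (by norm_num) (by linarith) hr0.le
      have c2 : 1 ≤ (135*q)^r := Real.one_le_rpow (by linarith) hr0.le
      calc (1:ℝ)+4^r ≤ 2*(135*q)^r := by linarith
        _ ≤ _ := le_mul_of_one_le_right (by positivity) hB3
    have a3 : 40*(16*r)^r * b^(r+1) ≤ (135*q)^r * B^3 := by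
      calc 40*(16*r)^r * b^(r+1) ≤ (112*q)^r * B^3 := by gcongr
        _ ≤ (135*q)^r * B^3 := by gcongr
    calc t * (1 + 4^r + 40*(16*r)^r * b^(r+1)) ≤ t * (3 * (135*q)^r * B^3) := by
          apply mul_le_mul_of_nonneg_left _ ht.le; linarith
      _ ≤ t * ((2000*r*K)^r * B^3) := by gcongr
      _ ≤ _ := by
        rw [mul_comm]; gcongr; exact le_max_left _ _

lemma EqRen.moments {Ω : Type*} [MeasurableSpace Ω] {μ : Measure Ω} [IsProbabilityMeasure μ] {S : Ω → ℝ} {x : ℕ → Ω → ℝ}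
    (h : EqRen μ S x) (r : ℝ) (hr : 2 < r) (hi : Integrable (fun ω => S ω ^ r) μ) (t : ℝ) (ht : 0 < t) :
    Integrable (fun ω => |Nr x t ω - t| ^ r) μ ∧ ∫ ω, (Nr x t ω - t) ∂μ = 0 ∧
    ∫ ω, (Nr x t ω - t)^2 ∂μ ≤ (2000*r*(5*r/(r-2)))^2 * (∫ ω, S ω ^ r ∂μ)^(6/r) * t ∧
    ∫ ω, |Nr x t ω - t| ^ r ∂μ ≤ (2000*r*(5*r/(r-2)))^r * (∫ ω, S ω ^ r ∂μ)^3 * max t (t^(r/2)) := by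
  have hmr := h.mom_r r hr hi t ht
  obtain ⟨h2, hb1, hbB, hB1⟩ := base_moments S h.Smeas h.Snn h.ES r hr hi
  set B := ∫ ω, S ω ^ r ∂μ with hB
  set b := ∫ ω, S ω ^ 2 ∂μ with hb
  have hr0 : 0 < r := by linarith
  have hr2 : 0 < r - 2 := by linarith
  have hK : 5 ≤ 5*r/(r-2) := by rw [le_div_iff₀ hr2]; linarith
  set K := 5*r/(r-2) with hKd
  have hq : 5 * r ≤ r*K := by nlinarith
  have hq10 : 10 ≤ r*K := by linarith
  obtain ⟨n1, n2, n3⟩ := num_aux r b B (r*K) hr hb1 hbB hB1 hq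
  have mN := measurable_Nr x h.meas t
  have md : Measurable (fun ω => Nr x t ω - t) := mN.sub measurable_const
  have mr : Measurable (fun ω => |Nr x t ω - t| ^ r) := by fun_prop
  have int1 : Integrable (fun ω => |Nr x t ω - t| ^ r) μ := by
    refine ⟨mr.aestronglyMeasurable, ?_⟩
    rw [hasFiniteIntegral_iff_ofReal (Filter.Eventually.of_forall fun ω => by positivity)]
    exact hmr.trans_lt ENNReal.ofReal_lt_top
  have b4 : ∫ ω, |Nr x t ω - t| ^ r ∂μ ≤ (2000*r*K)^r * B^3 * max t (t^(r/2)) := by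
    rw [integral_eq_lintegral_of_nonneg_ae (Filter.Eventually.of_forall fun ω => by positivity) mr.aestronglyMeasurable]
    exact ENNReal.toReal_le_of_le_ofReal (by positivity) hmr
  refine ⟨int1, ?_, ?_, b4⟩
  · have e : ∫⁻ ω, ENNReal.ofReal (Nr x t ω) ∂μ = ENNReal.ofReal t := by
      rw [← h.lint_cnt h2 hb1 t]
      refine lintegral_congr_ae ?_
      filter_upwards [h.good h2 hb1] with ω hω
      exact ENNReal.ofReal_toReal (hω t)
    have nn : ∀ ω, 0 ≤ Nr x t ω := fun ω => ENNReal.toReal_nonneg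
    have iN : Integrable (Nr x t) μ := by
      refine ⟨mN.aestronglyMeasurable, ?_⟩
      rw [hasFiniteIntegral_iff_ofReal (Filter.Eventually.of_forall nn), e]
      exact ENNReal.ofReal_lt_top
    rw [integral_sub iN (integrable_const t), integral_eq_lintegral_of_nonneg_ae (Filter.Eventually.of_forall nn) mN.aestronglyMeasurable, e,
      ENNReal.toReal_ofReal ht.le]
    simp
  · rcases le_total 1 t with h1 | h1
    · have ly := lyapunov md (p := 2) (r := r) (by norm_num) hr.le hr0 int1
      simp only [Real.rpow_two, sq_abs] at ly
      refine ly.trans ?_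
      have hT1 : t ≤ t^(r/2) := by
        calc t = t^(1:ℝ) := by simp
          _ ≤ _ := Real.rpow_le_rpow_of_exponent_le h1 (by linarith)
      rw [max_eq_right hT1] at b4
      calc _ ≤ ((2000*r*K)^r * B^3 * t^(r/2))^(2/r) :=
            Real.rpow_le_rpow (integral_nonneg fun ω => by positivity) b4 (by positivity)
        _ = _ := by
          rw [Real.mul_rpow (by positivity) (by positivity), Real.mul_rpow (by positivity) (by positivity),
            ← Real.rpow_mul (by positivity), ← Real.rpow_mul (by positivity), ← Real.rpow_natCast B 3, ← Real.rpow_mul (by positivity)]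
          rw [show r * (2/r) = 2 by field_simp, show r/2*(2/r) = 1 by field_simp, Real.rpow_one, Real.rpow_two]
          congr 3; push_cast; ring
    · have m2 := h.mom_small h2 hb1 2 le_rfl t ht h1
      have m2' : Measurable (fun ω => (Nr x t ω - t)^2) := by fun_prop
      rw [integral_eq_lintegral_of_nonneg_ae (Filter.Eventually.of_forall fun ω => by positivity) m2'.aestronglyMeasurable]
      simp only [Real.rpow_two, sq_abs] at m2
      refine (ENNReal.toReal_le_of_le_ofReal (by positivity) m2).trans ?_
      rw [← hb, mul_comm]
      apply mul_le_mul_of_nonneg_right _ ht.le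
      have c1 : b^((2:ℝ)+1) = b^3 := by rw [show (2:ℝ)+1 = (3:ℕ) by norm_num, Real.rpow_natCast]
      rw [c1]
      have c2 : (1:ℝ) ≤ B^(6/r) := Real.one_le_rpow hB1 (by positivity)
      have c3 : (20000:ℝ)^2 ≤ (2000*r*K)^2 := by
        apply pow_le_pow_left₀ (by norm_num); rw [mul_assoc]; linarith
      calc 1+4^2+40*(16*2)^2*b^3 ≤ 41000 * B^(6/r) := by norm_num; linarith
        _ ≤ _ := by
          apply mul_le_mul_of_nonneg_right _ (by linarith); linarith

lemma group_indep {Ω : Type*} [MeasurableSpace Ω] {μ : Measure Ω} [IsProbabilityMeasure μ] (X : ℕ → ℕ → Ω → ℝ)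
    (mX : ∀ i j, Measurable (X i j)) (h : iIndepFun (fun p : ℕ × ℕ => X p.1 p.2) μ) :
    iIndepFun (fun (i : ℕ) (ω : Ω) (j : ℕ) => X i j ω) μ := by
  have h' : iIndepFun (fun (p : (_ : ℕ) × ℕ) ω => X p.1 p.2 ω) μ :=
    h.precomp (g := fun p : (_ : ℕ) × ℕ => (p.1, p.2)) (fun a b hab => by
      cases a; cases b; simp only [Prod.mk.injEq] at hab; rw [hab.1, hab.2])
  have : ∀ i j, IsProbabilityMeasure (μ.map (X i j)) :=
    fun i j ↦ Measure.isProbabilityMeasure_map (mX i j).aemeasurable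
  have e : (MeasurableEquiv.piCurry (fun (_ : ℕ) (_ : ℕ) => ℝ)) ∘ (fun ω (p : (_ : ℕ) × ℕ) ↦ X p.1 p.2 ω) = fun ω i j ↦ X i j ω := by
    ext; simp [Sigma.curry]
  rw [iIndepFun_iff_map_fun_eq_infinitePi_map (by fun_prop)]
  rw [← e, ← Measure.map_map (by fun_prop) (by fun_prop), (iIndepFun_iff_map_fun_eq_infinitePi_map (by fun_prop)).1 h',
    Measure.infinitePi_map_piCurry (fun i j ↦ μ.map (X i j))]
  congr 1
  funext i
  refine ((iIndepFun_iff_map_fun_eq_infinitePi_map (by fun_prop)).1 ?_).symm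
  exact h.precomp (g := fun j : ℕ => (i, j)) (fun a b hab => by simpa using hab)

lemma server_inc {Ω : Type*} [MeasurableSpace Ω] {μ : Measure Ω} [IsProbabilityMeasure μ] {S : Ω → ℝ} (x : ℕ → ℕ → Ω → ℝ)
    (h : ∀ i, EqRen μ S (x i)) (hind : iIndepFun (fun (i : ℕ) (ω : Ω) (j : ℕ) => x i j ω) μ)
    (r : ℝ) (hr : 2 < r) (hi : Integrable (fun ω => S ω ^ r) μ) (n : ℕ) (hn : 1 ≤ n) (j k : ℕ) (hk : 1 ≤ k) :
    ∫⁻ ω, ENNReal.ofReal (|((∑ i ∈ Finset.range n, (Nr (x i) (((j+k:ℕ):ℝ)/n) ω - Nr (x i) 0 ω)) - ((j+k:ℕ):ℝ))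
      - ((∑ i ∈ Finset.range n, (Nr (x i) ((j:ℝ)/n) ω - Nr (x i) 0 ω)) - (j:ℝ))| ^ r) ∂μ
      ≤ ENNReal.ofReal ((18000*r^2*(5*r/(r-2)))^r * (∫ ω, S ω ^ r ∂μ)^3 * (k:ℝ)^(r/2)) := by
  have hn0 : (0:ℝ) < n := by exact_mod_cast hn
  have hk1 : (1:ℝ) ≤ k := by exact_mod_cast hk
  have hr0 : 0 < r := by linarith
  have hr2 : 0 < r - 2 := by linarith
  obtain ⟨h2, hb1, hbB, hB1⟩ := base_moments S (h 0).Smeas (h 0).Snn (h 0).ES r hr hi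
  set t : ℝ := k/n with ht
  set s : ℝ := j/n with hs
  have ht0 : 0 < t := by positivity
  have hs0 : 0 ≤ s := by positivity
  set B := ∫ ω, S ω ^ r ∂μ with hB
  have hK : 5 ≤ 5*r/(r-2) := by rw [le_div_iff₀ hr2]; linarith
  set K := 5*r/(r-2) with hKd
  set D := 2000*r*K with hD
  have hD0 : 0 < D := by positivity
  have mN := fun i => measurable_Nr (x i) (h i).meas
  set W : ℕ → Ω → ℝ := fun i ω => Nr (x i) (s+t) ω - Nr (x i) s ω - t with hW
  have mW : ∀ i, Measurable (W i) := fun i => ((mN i _).sub (mN i _)).sub measurable_const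
  have hWind : iIndepFun W μ := by
    have := hind.comp (fun _ a => (cnt a (s+t)).toReal - (cnt a s).toReal - t) (fun _ =>
      ((measurable_cnt _).ennreal_toReal.sub (measurable_cnt _).ennreal_toReal).sub measurable_const)
    exact this
  have hid : ∀ i, IdentDistrib (W i) (fun ω => Nr (x i) t ω - t) μ μ := fun i =>
    (show IdentDistrib (fun ω => Nr (x i) (s+t) ω - Nr (x i) s ω) (Nr (x i) t) μ μ from
      ⟨((mN i _).sub (mN i _)).aemeasurable, (mN i _).aemeasurable, (h i).law_inc h2 hb1 s t hs0 ht0.le⟩).comp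
      (u := fun z : ℝ => z - t) (by fun_prop)
  have hidr : ∀ i, IdentDistrib (fun ω => |W i ω| ^ r) (fun ω => |Nr (x i) t ω - t| ^ r) μ μ := fun i =>
    (hid i).comp (u := fun z : ℝ => |z| ^ r) (by fun_prop)
  have hid2 : ∀ i, IdentDistrib (fun ω => (W i ω) ^ 2) (fun ω => (Nr (x i) t ω - t) ^ 2) μ μ := fun i =>
    (hid i).comp (u := fun z : ℝ => z ^ 2) (by fun_prop)
  have mom := fun i => (h i).moments r hr hi t ht0
  obtain ⟨R1, R2⟩ := rosenthal W mW hWind r hr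
    (fun i => (hidr i).integrable_iff.2 (mom i).1)
    (fun i => by rw [(hid i).integral_eq]; exact (mom i).2.1)
    (D^2 * B^(6/r) * t) (D^r * B^3 * max t (t^(r/2)))
    (fun i => by rw [(hid2 i).integral_eq]; exact (mom i).2.2.1)
    (fun i => by rw [(hidr i).integral_eq]; exact (mom i).2.2.2) n hn
  have e : ∀ ω, ((∑ i ∈ Finset.range n, (Nr (x i) (((j+k:ℕ):ℝ)/n) ω - Nr (x i) 0 ω)) - ((j+k:ℕ):ℝ))
      - ((∑ i ∈ Finset.range n, (Nr (x i) ((j:ℝ)/n) ω - Nr (x i) 0 ω)) - (j:ℝ)) = ∑ i ∈ Finset.range n, W i ω := by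
    intro ω
    have e1 : ((j+k:ℕ):ℝ)/n = s + t := by rw [hs, ht]; push_cast; ring
    have e2 : (n:ℝ) * t = k := by rw [ht]; field_simp
    rw [e1]
    simp only [hW, Finset.sum_sub_distrib, Finset.sum_const, Finset.card_range, nsmul_eq_mul, e2]
    push_cast; ring
  refine le_trans (le_of_eq (lintegral_congr fun ω => congrArg (fun z => ENNReal.ofReal (|z|^r)) (e ω))) ?_
  rw [← ofReal_integral_eq_lintegral_ofReal R1 (Filter.Eventually.of_forall fun ω => by positivity)]
  apply ENNReal.ofReal_le_ofReal
  refine R2.trans ?_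
  have hkk : (k:ℝ) ≤ (k:ℝ)^(r/2) := by
    calc (k:ℝ) = (k:ℝ)^(1:ℝ) := by simp
      _ ≤ _ := Real.rpow_le_rpow_of_exponent_le hk1 (by linarith)
  have c1 : (6*r^2*n*(D^2 * B^(6/r) * t))^(r/2) ≤ (3*r*D)^r * (B^3 * (k:ℝ)^(r/2)) := by
    calc (6*r^2*n*(D^2 * B^(6/r) * t))^(r/2) ≤ ((3*r*D)^2 * (B^(6/r) * k))^(r/2) := by
          apply Real.rpow_le_rpow (by positivity) _ (by positivity)
          have : 6*r^2*n*(D^2 * B^(6/r) * t) = 6 * (r^2 * D^2 * (B^(6/r) * k)) := by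
            rw [ht]; field_simp
          rw [this]
          have : (3*r*D)^2 * (B^(6/r) * k) = 9 * (r^2 * D^2 * (B^(6/r) * k)) := by ring
          rw [this]
          have : 0 ≤ r^2 * D^2 * (B^(6/r) * k) := by positivity
          linarith
      _ = _ := by
          rw [Real.mul_rpow (by positivity) (by positivity), Real.mul_rpow (x := B^(6/r)) (by positivity) (by positivity),
            ← Real.rpow_mul (by positivity), ← Real.rpow_natCast (3*r*D) 2, ← Real.rpow_mul (by positivity), ← Real.rpow_natCast B 3]
          rw [show ((2:ℕ):ℝ) * (r/2) = r by push_cast; ring, show 6/r*(r/2) = ((3:ℕ):ℝ) by field_simp; norm_num]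
  have c2 : 2*(1+r)^r*n*(D^r * B^3 * max t (t^(r/2))) ≤ 2 * (3*r*D)^r * (B^3 * (k:ℝ)^(r/2)) := by
    have a1 : (1+r)^r * D^r ≤ (3*r*D)^r := by
      rw [← Real.mul_rpow (by positivity) (by positivity)]
      apply Real.rpow_le_rpow (by positivity) _ hr0.le
      gcongr; linarith
    have a2 : n * max t (t^(r/2)) ≤ (k:ℝ)^(r/2) := by
      rcases max_choice t (t^(r/2)) with hh | hh <;> rw [hh]
      · have e2 : (n:ℝ) * t = k := by rw [ht]; field_simp
        rw [e2]; exact hkk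
      · rw [ht, Real.div_rpow (by positivity) (by positivity)]
        have : (n:ℝ) ≤ (n:ℝ)^(r/2) := by
          calc (n:ℝ) = (n:ℝ)^(1:ℝ) := by simp
            _ ≤ _ := Real.rpow_le_rpow_of_exponent_le (by exact_mod_cast hn) (by linarith)
        rw [mul_div_assoc', div_le_iff₀ (by positivity), mul_comm]
        gcongr
    calc 2*(1+r)^r*n*(D^r * B^3 * max t (t^(r/2))) = 2 * ((1+r)^r * D^r) * (B^3 * (n * max t (t^(r/2)))) := by ring
      _ ≤ _ := by gcongr
  have c3 : 3 * (3*r*D)^r ≤ (18000*r^2*K)^r := by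
    calc 3 * (3*r*D)^r ≤ 3^r * (3*r*D)^r := by
          apply mul_le_mul_of_nonneg_right _ (by positivity)
          exact le_rpow_of_two_le _ _ _ (by norm_num) hr.le (by norm_num) (by norm_num)
      _ = _ := by
        rw [← Real.mul_rpow (by norm_num) (by positivity)]; congr 1; rw [hD]; ring
  have c4 : 3 * (3*r*D)^r * (B^3 * (k:ℝ)^(r/2)) ≤ (18000*r^2*K)^r * (B^3 * (k:ℝ)^(r/2)) := by gcongr
  linarith

lemma renewalCount_sum_le (a : ℕ → ℝ) (t : ℝ) (h : 1 ≤ renewalCount a t) :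
    ∑ i ∈ Finset.range (renewalCount a t), a i ≤ t := by
  have hne : {n : ℕ | ∑ i ∈ Finset.range n, a i ≤ t}.Nonempty := by
    by_contra hc
    rw [Set.not_nonempty_iff_eq_empty] at hc
    unfold renewalCount at h
    rw [hc] at h; simp at h
  have hbd : BddAbove {n : ℕ | ∑ i ∈ Finset.range n, a i ≤ t} := by
    by_contra hc
    have : renewalCount a t = 0 := by
      unfold renewalCount
      exact Nat.sSup_of_not_bddAbove hc
    omega
  exact Nat.sSup_mem hne hbd

/-- the deterministic part of the final combination -/
lemma final_arith (z ρ ε a k u v w : ℝ) (hz : 12 ≤ z) (hρ : 0 < ρ) (hε : 0 < ε) (hρε : ε = 1 - ρ) (ha : 0 ≤ a) (hk : 0 ≤ k)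
    (h1 : a + u ≤ ρ * (k+1)) (h2 : v + k ≤ w) (h3 : z/2 < a + 1 - w) (hu : |u| < (z+ε*a)/8) (hv : |v| < (z+ε*k)/8) : False := by
  have u1 := (abs_lt.1 hu).1
  have v1 := (abs_lt.1 hv).1
  subst hρε
  have hε1 : (1-ρ) ≤ 1 := by linarith
  have q1 : ρ * (k+1) = k + 1 - (1-ρ)*k - (1-ρ) := by ring
  have hek : 0 ≤ (1-ρ)*k := by positivity
  have hea : (1-ρ)*a ≤ a := by nlinarith
  have hea0 : 0 ≤ (1-ρ)*a := by positivity
  -- a * 7/8 ≤ ρ k + 1 + z/8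
  have a1 : (1-ρ)*(a*(7/8)) ≤ (1-ρ)*(k + 1 + z/8) := by
    apply mul_le_mul_of_nonneg_left _ hε.le
    linarith
  have a2 : (1-ρ)*(1 + z/8) ≤ 1 + z/8 := by nlinarith
  nlinarith

lemma num_final (r : ℝ) (hr : 2 < r) : 12 ≤ (10^26 * r^8 * (r-2)^(-3:ℝ)) ∧
    64 * (5*r/(r-2)) * (18000*r^2*(5*r/(r-2))) ≤ (10^26 * r^8 * (r-2)^(-3:ℝ)) := by
  have hs : 0 < r - 2 := by linarith
  have e : (r-2)^(-3:ℝ) = ((r-2)^3)⁻¹ := by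
    rw [Real.rpow_neg hs.le]; norm_cast
  rw [e]
  set s := r - 2 with hsd
  have hrs : s ≤ r := by linarith
  have hs3 : 0 < s^3 := by positivity
  have h1 : s^3 ≤ r^3 := by gcongr
  have hr1 : 1 ≤ r := by linarith
  have h2 : r^3 ≤ r^8 := pow_le_pow_right₀ hr1 (by norm_num)
  constructor
  · rw [← div_eq_mul_inv, le_div_iff₀ hs3]
    nlinarith
  · rw [← div_eq_mul_inv, le_div_iff₀ hs3]
    have : 64 * (5*r/s) * (18000*r^2*(5*r/s)) * s^3 = 28800000 * (r^4 * s) := by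
      field_simp; ring
    rw [this]
    have h4 : r^4 * s ≤ r^4 * r^4 := by
      gcongr
      calc s ≤ r := hrs
        _ = r^1 := by ring
        _ ≤ r^4 := pow_le_pow_right₀ hr1 (by norm_num)
    have : r^8 = r^4*r^4 := by ring
    nlinarith [pow_pos (by linarith : 0 < r) 8]

lemma core {Ω : Type*} [MeasurableSpace Ω] {μ : Measure Ω} [IsProbabilityMeasure μ] {S X : Ω → ℝ} (x : ℕ → ℕ → Ω → ℝ)
    (h : ∀ i, EqRen μ S (x i)) (hind : iIndepFun (fun (i : ℕ) (ω : Ω) (j : ℕ) => x i j ω) μ)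
    (r : ℝ) (hr : 2 < r) (hi : Integrable (fun ω => S ω ^ r) μ)
    (hX : Measurable X) (hXn : ∀ ω, 0 ≤ X ω) (hXi : Integrable X μ) (hX1 : ∫ ω, X ω ∂μ = 1) (hXr : Integrable (fun ω => X ω ^ r) μ)
    (a : ℕ → Ω → ℝ) (am : ∀ j, Measurable (a j)) (an : ∀ j ω, 0 ≤ a j ω) (aind : iIndepFun a μ) (μA : ℝ) (hμA : 0 < μA)
    (alaw : ∀ j, μ.map (fun ω => μA * a (j+1) ω) = μ.map X)
    (n : ℕ) (hn : 1 ≤ n) (hρ : μA < n) (z : ℝ) (hz : 0 < z) :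
    (μ {ω | (z : EReal) ≤ ⨆ t : ℝ≥0,
          (((renewalCount (fun j => a j ω) (t : ℝ) : ℝ)
            - ∑ i ∈ Finset.range n, (renewalCount (fun j => x i j ω) (t : ℝ) : ℝ) : ℝ) : EReal)}).toReal
        ≤ (∫ ω, S ω ^ r ∂μ) ^ 3 * (∫ ω, X ω ^ r ∂μ)
            * (10 ^ 26 * r ^ 8 * (r - 2) ^ (-3 : ℝ)) ^ (4 * r)
            * (z * (1 - μA / (n : ℝ))) ^ (-(r / 2)) := by
  obtain ⟨h2, hb1, hbB, hB1⟩ := base_moments S (h 0).Smeas (h 0).Snn (h 0).ES r hr hi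
  obtain ⟨-, -, -, hA1⟩ := base_moments X hX hXn hX1 r hr hXr
  obtain ⟨hY1, hY2⟩ := num_final r hr
  have hr0 : 0 < r := by linarith
  have hr2 : 0 < r - 2 := by linarith
  have hn0 : (0:ℝ) < n := by exact_mod_cast hn
  set Y := 10 ^ 26 * r ^ 8 * (r - 2) ^ (-3 : ℝ) with hY
  have hK : 5 ≤ 5*r/(r-2) := by rw [le_div_iff₀ hr2]; linarith
  set K := 5*r/(r-2) with hKd
  set B := ∫ ω, S ω ^ r ∂μ with hB
  set BA := ∫ ω, X ω ^ r ∂μ with hBA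
  set ρ := μA / n with hρd
  have hρ0 : 0 < ρ := by positivity
  have hρ1 : ρ < 1 := by rw [hρd, div_lt_one hn0]; exact hρ
  obtain ⟨ε, hε⟩ : ∃ ε, ε = 1 - ρ := ⟨_, rfl⟩
  rw [← hε]
  have hε0 : 0 < ε := by linarith
  have hBB : 1 ≤ B^3 * BA := by
    have : 1 ≤ B^3 := one_le_pow₀ hB1
    nlinarith
  rcases lt_or_ge z 12 with hz12 | hz12
  · refine (measureReal_le_one (μ := μ)).trans ?_
    have c1 : (12:ℝ)^(-(r/2)) ≤ (z*ε)^(-(r/2)) := by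
      apply Real.rpow_le_rpow_of_nonpos (by positivity) _ (by linarith)
      nlinarith
    have c2 : (12:ℝ)^(r/2) ≤ Y^(4*r) := by
      calc (12:ℝ)^(r/2) ≤ Y^(r/2) := Real.rpow_le_rpow (by norm_num) hY1 (by positivity)
        _ ≤ _ := Real.rpow_le_rpow_of_exponent_le (by linarith) (by linarith)
    calc (1:ℝ) = 1 * ((12:ℝ)^(r/2) * (12:ℝ)^(-(r/2))) := by
          rw [← Real.rpow_add (by norm_num)]; simp
      _ ≤ (B^3 * BA) * (Y^(4*r) * (z*ε)^(-(r/2))) := by gcongr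
      _ = _ := by ring
  -- the two random walks
  set Z : ℕ → Ω → ℝ := fun k ω => ∑ i ∈ Finset.range k, (μA * a (i+1) ω - 1) with hZ
  set V : ℕ → Ω → ℝ := fun k ω => (∑ i ∈ Finset.range n, (Nr (x i) ((k:ℝ)/n) ω - Nr (x i) 0 ω)) - (k:ℝ) with hV
  have mN := fun i => measurable_Nr (x i) (h i).meas
  have mZ : ∀ k, Measurable (Z k) := fun k => by simp only [hZ]; fun_prop
  have mV : ∀ k, Measurable (V k) := fun k => by
    simp only [hV]
    exact (Finset.measurable_fun_sum _ fun i _ => (mN i _).sub (mN i _)).sub measurable_const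
  have chZ := chain r hr Z ((15*r)^r * BA) (by positivity) mZ (by simp [hZ]) (fun j k hk => 
    iid_inc X hX hXn hXi hX1 r hr hXr (fun i ω => μA * a (i+1) ω) (fun i => (am _).const_mul _)
      ((aind.precomp (g := fun i => i+1) (fun a b hab => by simpa using hab)).comp (fun _ z => μA * z) (fun _ => by fun_prop))
      alaw j k hk)
  have chV := chain r hr V ((18000*r^2*K)^r * B^3) (by positivity) mV (by simp [hV]) (fun j k hk => 
    server_inc x h hind r hr hi n hn j k hk)
  have tZ := tail_sum r hr Z (K^r * ((15*r)^r * BA)) (by positivity) mZ chZ z ε hz hε0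
  have tV := tail_sum r hr V (K^r * ((18000*r^2*K)^r * B^3)) (by positivity) mV chV z ε hz hε0
  set E1 := {ω | ∃ k : ℕ, 1 ≤ k ∧ (z+ε*k)/8 ≤ |Z k ω|} with hE1
  set E2 := {ω | ∃ k : ℕ, 1 ≤ k ∧ (z+ε*k)/8 ≤ |V k ω|} with hE2
  have sub : ∀ᵐ ω ∂μ, ω ∈ {ω | (z : EReal) ≤ ⨆ t : ℝ≥0,
          (((renewalCount (fun j => a j ω) (t : ℝ) : ℝ)
            - ∑ i ∈ Finset.range n, (renewalCount (fun j => x i j ω) (t : ℝ) : ℝ) : ℝ) : EReal)} → ω ∈ E1 ∪ E2 := by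
    filter_upwards [ae_all_iff.2 fun i => (h i).spec h2 hb1] with ω hω hsup
    by_contra hc
    rw [Set.mem_union, not_or] at hc
    obtain ⟨hc1, hc2⟩ := hc
    have hz2 : ((z/2:ℝ):EReal) < z := by
      rw [EReal.coe_lt_coe_iff]; linarith
    obtain ⟨t, ht⟩ := lt_iSup_iff.1 (hz2.trans_le hsup)
    rw [EReal.coe_lt_coe_iff] at ht
    set A := renewalCount (fun j => a j ω) (t : ℝ) with hA
    set w := ∑ i ∈ Finset.range n, (renewalCount (fun j => x i j ω) (t : ℝ) : ℝ) with hw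
    have hw0 : 0 ≤ w := Finset.sum_nonneg fun i _ => by positivity
    have hA1 : 1 ≤ A := by
      by_contra hcc
      have : A = 0 := by omega
      rw [this] at ht; simp at ht; linarith
    have hsum := renewalCount_sum_le (fun j => a j ω) t hA1
    rw [← hA] at hsum
    obtain ⟨a', ha'⟩ : ∃ a', A = a' + 1 := ⟨A - 1, by omega⟩
    have htn : (0:ℝ) ≤ t := t.2
    set k := ⌊(n:ℝ) * t⌋₊ with hk
    have hk1 : (k:ℝ) ≤ n * t := Nat.floor_le (by positivity)
    have hk2 : (n:ℝ) * t < k + 1 := Nat.lt_floor_add_one _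
    have g1 : (a':ℝ) + Z a' ω ≤ ρ * (k+1) := by
      have e1 : Z a' ω = μA * ∑ i ∈ Finset.range a', a (i+1) ω - a' := by
        simp [hZ, Finset.mul_sum]
      rw [ha', Finset.sum_range_succ'] at hsum
      have e2 : ∑ i ∈ Finset.range a', a (i+1) ω ≤ t := by linarith [an 0 ω]
      have e3 : μA * t ≤ ρ * (k+1) := by
        have : μA * t = ρ * (n*t) := by rw [hρd]; field_simp
        rw [this]; gcongr
      have e4 : μA * ∑ i ∈ Finset.range a', a (i+1) ω ≤ μA * t := by gcongr
      linarith
    have g2 : V k ω + k ≤ w := by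
      simp only [hV, hw, sub_add_cancel]
      apply Finset.sum_le_sum
      intro i _
      have hkn : (k:ℝ)/n ≤ t := by rw [div_le_iff₀ hn0]; linarith
      obtain ⟨n1, p1, -, p2⟩ := hω i ((k:ℝ)/n) (by positivity)
      obtain ⟨n2, -, q1, q2⟩ := hω i t htn
      have h0 : 0 ≤ Nr (x i) 0 ω := ENNReal.toReal_nonneg
      rw [p1, q1]
      have : n1 ≤ n2 := (q2 n1).1 (((p2 n1).2 le_rfl).trans hkn)
      have : (n1:ℝ) ≤ n2 := by exact_mod_cast this
      linarith
    have g3 : z/2 < (a':ℝ) + 1 - w := by rw [ha'] at ht; push_cast at ht; linarith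
    have g4 : |Z a' ω| < (z+ε*a')/8 := by
      rcases Nat.eq_zero_or_pos a' with h0 | h0
      · rw [h0]; simp [hZ]; linarith
      · by_contra hcc; push Not at hcc
        exact hc1 ⟨a', h0, hcc⟩
    have g5 : |V k ω| < (z+ε*k)/8 := by
      rcases Nat.eq_zero_or_pos k with h0 | h0
      · rw [h0]; simp [hV]; linarith
      · by_contra hcc; push Not at hcc
        exact hc2 ⟨k, h0, hcc⟩
    exact final_arith z ρ ε a' k _ _ w hz12 hρ0 hε0 hε (by positivity) (by positivity) g1 g2 g3 g4 g5
  have fin : μ {ω | (z : EReal) ≤ ⨆ t : ℝ≥0,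
          (((renewalCount (fun j => a j ω) (t : ℝ) : ℝ)
            - ∑ i ∈ Finset.range n, (renewalCount (fun j => x i j ω) (t : ℝ) : ℝ) : ℝ) : EReal)} ≤
      ENNReal.ofReal (32^r * (K^r * ((15*r)^r * BA)) * (z*ε)^(-(r/2)) + 32^r * (K^r * ((18000*r^2*K)^r * B^3)) * (z*ε)^(-(r/2))) := by
    rw [ENNReal.ofReal_add (by positivity) (by positivity)]
    exact (measure_mono_ae sub).trans ((measure_union_le _ _).trans (add_le_add tZ tV))
  refine (ENNReal.toReal_le_of_le_ofReal (by positivity) fin).trans ?_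
  have hq : 0 ≤ (z*ε)^(-(r/2)) := by positivity
  rw [← add_mul]
  apply mul_le_mul_of_nonneg_right _ hq
  have d1 : (15*r)^r * BA ≤ (18000*r^2*K)^r * (B^3*BA) := by
    have : BA ≤ B^3 * BA := le_mul_of_one_le_left (by linarith) (one_le_pow₀ hB1)
    have : (15*r)^r ≤ (18000*r^2*K)^r := by
      apply Real.rpow_le_rpow (by positivity) _ hr0.le
      have : r ≤ r^2*K := by nlinarith
      nlinarith
    gcongr
  have d2 : (18000*r^2*K)^r * B^3 ≤ (18000*r^2*K)^r * (B^3*BA) := by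
    have : B^3 ≤ B^3 * BA := le_mul_of_one_le_right (by positivity) hA1
    gcongr
  have d3 : 2 * (32^r * (K^r * (18000*r^2*K)^r)) ≤ Y^(4*r) := by
    calc 2 * (32^r * (K^r * (18000*r^2*K)^r)) ≤ 2^r * (32^r * (K^r * (18000*r^2*K)^r)) := by
          apply mul_le_mul_of_nonneg_right _ (by positivity)
          exact le_rpow_of_two_le _ _ _ (by norm_num) hr.le (by norm_num) (by norm_num)
      _ = (64*K*(18000*r^2*K))^r := by
          rw [← Real.mul_rpow (by positivity) (by positivity), ← Real.mul_rpow (by positivity) (by positivity),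
            ← Real.mul_rpow (by positivity) (by positivity)]
          congr 1; ring
      _ ≤ Y^r := Real.rpow_le_rpow (by positivity) hY2 hr0.le
      _ ≤ _ := Real.rpow_le_rpow_of_exponent_le (by linarith) (by linarith)
  calc _ ≤ 32^r * (K^r * ((18000*r^2*K)^r * (B^3*BA))) + 32^r * (K^r * ((18000*r^2*K)^r * (B^3*BA))) := by gcongr
    _ = B^3*BA * (2 * (32^r * (K^r * (18000*r^2*K)^r))) := by ring
    _ ≤ _ := by gcongr

/-- Fully explicit tail bound for `sup_{t ≥ 0} (A(t) - ∑_{i=1}^{n'} N_i(t))`, where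
`A(·)` is the counting process of an equilibrium renewal process with renewal distribution
`Arv` (rate `μ_A`), and the `N_i` are counting processes of i.i.d. equilibrium renewal
processes with renewal distribution `S`, `E[S] = 1`, all jointly independent; `E[S^r]` and
`E[Arv^r]` are finite for some `r > 2`, and `ρ_{n'} = μ_A / n' < 1`.  Here `ξ 0` gives the
interval sequence of the arrival process and `ξ (i+1)` that of the `i`-th service renewal
process. -/
theorem explicit_supremum_bound
    {Ω : Type*} [MeasurableSpace Ω] (μ : Measure Ω) [IsProbabilityMeasure μ]
    (S Arv : Ω → ℝ) (hSmeas : Measurable S) (hArvmeas : Measurable Arv)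
    (hSnn : ∀ᵐ ω ∂μ, 0 ≤ S ω) (hArvnn : ∀ᵐ ω ∂μ, 0 ≤ Arv ω)
    (hES : ∫ ω, S ω ∂μ = 1)
    (hArvint : Integrable Arv μ) (hEArv : 0 < ∫ ω, Arv ω ∂μ)
    (μA : ℝ) (hμA : μA = (∫ ω, Arv ω ∂μ)⁻¹)
    (r : ℝ) (hr : 2 < r)
    (hSr : Integrable (fun ω => S ω ^ r) μ)
    (hAr : Integrable (fun ω => Arv ω ^ r) μ)
    (ξ : ℕ → ℕ → Ω → ℝ)
    (hξmeas : ∀ i j, Measurable (ξ i j))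
    (hξnn : ∀ i j, ∀ᵐ ω ∂μ, 0 ≤ ξ i j ω)
    (hindep : iIndepFun (fun p : ℕ × ℕ => ξ p.1 p.2) μ)
    (hlawA : ∀ j, μ.map (ξ 0 (j + 1)) = μ.map Arv)
    (hlawS : ∀ i j, μ.map (ξ (i + 1) (j + 1)) = μ.map S)
    (heqA : ∀ y : ℝ, 0 ≤ y →
      (μ {ω | y < ξ 0 0 ω}).toReal = μA * ∫ z in Set.Ioi y, (μ {ω | z < Arv ω}).toReal)
    (heqS : ∀ i, ∀ y : ℝ, 0 ≤ y →
      (μ {ω | y < ξ (i + 1) 0 ω}).toReal = ∫ z in Set.Ioi y, (μ {ω | z < S ω}).toReal)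
    (n' : ℕ) (hn' : 1 ≤ n') (hρ : μA < (n' : ℝ)) :
    ∀ z : ℝ, 0 < z →
      (μ {ω | (z : EReal) ≤ ⨆ t : ℝ≥0,
          (((renewalCount (fun j => ξ 0 j ω) (t : ℝ) : ℝ)
            - ∑ i ∈ Finset.range n', (renewalCount (fun j => ξ (i + 1) j ω) (t : ℝ) : ℝ) : ℝ) : EReal)}).toReal
        ≤ (∫ ω, S ω ^ r ∂μ) ^ 3 * (∫ ω, Arv ω ^ r ∂μ) * μA ^ r
            * (10 ^ 26 * r ^ 8 * (r - 2) ^ (-3 : ℝ)) ^ (4 * r)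
            * (z * (1 - μA / (n' : ℝ))) ^ (-(r / 2)) := by
  intro z hz
  have hr0 : 0 < r := by linarith
  have hμA0 : 0 < μA := by rw [hμA]; exact inv_pos.2 hEArv
  set S' : Ω → ℝ := fun ω => max (S ω) 0 with hS'
  set X : Ω → ℝ := fun ω => μA * max (Arv ω) 0 with hX
  set x : ℕ → ℕ → Ω → ℝ := fun i j ω => max (ξ i j ω) 0 with hx
  have mx : ∀ i j, Measurable (x i j) := fun i j => (hξmeas i j).max measurable_const
  have mS' : Measurable S' := hSmeas.max measurable_const
  have mX : Measurable X := (hArvmeas.max measurable_const).const_mul _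
  have nx : ∀ i j ω, 0 ≤ x i j ω := fun i j ω => le_max_right _ _
  have eS : S' =ᵐ[μ] S := by filter_upwards [hSnn] with ω hω using max_eq_left hω
  have eA : X =ᵐ[μ] fun ω => μA * Arv ω := by
    filter_upwards [hArvnn] with ω hω
    simp only [hX]; rw [max_eq_left hω]
  have ex : ∀ i j, x i j =ᵐ[μ] ξ i j := fun i j => by
    filter_upwards [hξnn i j] with ω hω using max_eq_left hω
  have iS : Integrable S μ := by
    by_contra hc
    rw [integral_undef hc] at hES
    norm_num at hES
  have eSr : (fun ω => S' ω ^ r) =ᵐ[μ] fun ω => S ω ^ r := by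
    filter_upwards [eS] with ω hω
    rw [hω]
  have eAr : (fun ω => X ω ^ r) =ᵐ[μ] fun ω => μA ^ r * Arv ω ^ r := by
    filter_upwards [eA, hArvnn] with ω hω hn
    rw [hω, Real.mul_rpow hμA0.le hn]
  have ind2 : iIndepFun (fun p : ℕ × ℕ => x p.1 p.2) μ :=
    hindep.comp (fun _ u => max u 0) (fun _ => by fun_prop)
  have indrow : ∀ i, iIndepFun (x i) μ := fun i =>
    ind2.precomp (g := fun j : ℕ => (i, j)) (fun a b hab => by simpa using hab)
  have hset : ∀ (f : Ω → ℝ) (y : ℝ), 0 ≤ y → {ω | y < max (f ω) 0} = {ω | y < f ω} := by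
    intro f y hy
    ext ω
    simp only [Set.mem_ofPred_eq, lt_max_iff]
    constructor
    · rintro (h | h)
      · exact h
      · linarith
    · exact Or.inl
  have hEq : ∀ i, EqRen μ S' (x (i+1)) := fun i =>
    { meas := mx _
      nn := nx _
      ind := indrow _
      law := fun j => by rw [Measure.map_congr (ex _ _), hlawS, Measure.map_congr eS]
      Smeas := mS'
      Snn := fun ω => le_max_right _ _
      Sint := iS.congr eS.symm
      ES := by rw [integral_congr_ae eS, hES]
      eq := fun y hy => by
        have e1 := hset (ξ (i+1) 0) y hy
        simp only [hx, hS']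
        rw [e1, heqS i y hy]
        refine setIntegral_congr_fun measurableSet_Ioi fun u hu => ?_
        have hu' : y < u := hu
        simp only [hset S u (by linarith)] }
  have hgrp := (group_indep x mx ind2).precomp (g := fun i : ℕ => i + 1) (fun a b hab => by simpa using hab)
  have hAint : ∫ ω, X ω ∂μ = 1 := by
    rw [integral_congr_ae eA, integral_const_mul, hμA, inv_mul_cancel₀ hEArv.ne']
  have hcore := core (S := S') (X := X) (fun i => x (i+1)) hEq hgrp r hr (hSr.congr eSr.symm) mX
    (fun ω => mul_nonneg hμA0.le (le_max_right _ _)) ((hArvint.const_mul μA).congr eA.symm) hAint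
    ((hAr.const_mul (μA^r)).congr eAr.symm) (x 0) (mx 0) (nx 0) (indrow 0) μA hμA0
    (fun j => by
      have e1 : (fun ω => μA * x 0 (j+1) ω) =ᵐ[μ] fun ω => μA * ξ 0 (j+1) ω := by
        filter_upwards [ex 0 (j+1)] with ω hω
        rw [hω]
      rw [Measure.map_congr e1, Measure.map_congr eA]
      have e2 := Measure.map_map (μ := μ) (show Measurable (fun u : ℝ => μA * u) by fun_prop) (hξmeas 0 (j+1))
      have e3 := Measure.map_map (μ := μ) (show Measurable (fun u : ℝ => μA * u) by fun_prop) hArvmeas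
      rw [hlawA] at e2
      exact e2.symm.trans e3)
    n' hn' hρ z hz
  rw [integral_congr_ae eSr, integral_congr_ae eAr, integral_const_mul] at hcore
  have hall : ∀ᵐ ω ∂μ, ∀ i j, x i j ω = ξ i j ω := ae_all_iff.2 fun i => ae_all_iff.2 fun j => ex i j
  refine le_trans (le_of_eq ?_) (hcore.trans (le_of_eq (by ring)))
  congr 1
  refine measure_congr ?_
  filter_upwards [hall] with ω hω
  show (_ ≤ _) = (_ ≤ _)
  simp only [hω]
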